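/- Let k ≥ 1 be a fixed integer and p(n) = (log n + (k+1)·log log n − log log log n)/n. Then almost surely δ(G(n,p)) − 1 = λ(G(n,p)) − 1 = κ(G(n,p)) − 1 ≤ κ₃(G(n,p)) ≤ λ₃(G(n,p)) ≤ κ(G(n,p)) = λ(G(n,p)) = δ(G(n,p)), where κ, λ, δ denote vertex connectivity, edge connectivity and minimum degree respectively. -/

import Mathlib

open Filter Asymptotics
open scoped Classical

noncomputable section

/-- The number of edges of a simple graph on a finite vertex type. -/
def edgeCount {V : Type*} [Fintype V] (G : SimpleGraph V) : ℕ :=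
  G.edgeFinset.card

/-- Probability in the Erdős–Rényi model `G(n,p)` of a set `A` of graphs on `Fin n`:
each of the `n.choose 2` possible edges is present independently with probability `p`. -/
def gnpProb (n : ℕ) (p : ℝ) (A : Set (SimpleGraph (Fin n))) : ℝ :=
  ∑ G ∈ Finset.univ.filter (fun G => G ∈ A),
    p ^ edgeCount G * (1 - p) ^ (n.choose 2 - edgeCount G)

/-- Probability in the uniform model `G(n,M)` of a set `A` of graphs on `Fin n`:
all graphs with exactly `M` edges are equally likely. -/
def gnmProb (n M : ℕ) (A : Set (SimpleGraph (Fin n))) : ℝ :=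
  ((Finset.univ.filter (fun G : SimpleGraph (Fin n) => edgeCount G = M ∧ G ∈ A)).card : ℝ) /
    ((Finset.univ.filter (fun G : SimpleGraph (Fin n) => edgeCount G = M)).card : ℝ)

/-- `κ(S)`: the largest number of internally disjoint trees connecting `S`, i.e. trees
`T₁, …, T_k` of `G` with `S ⊆ V(Tᵢ)`, `V(Tᵢ) ∩ V(Tⱼ) = S` and `E(Tᵢ) ∩ E(Tⱼ) = ∅`
for `i ≠ j`. -/
def kappaSet {V : Type*} (G : SimpleGraph V) (S : Set V) : ℕ :=
  sSup {k | ∃ T : Fin k → G.Subgraph,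
    (∀ i, S ⊆ (T i).verts ∧ ((T i).coe).IsTree) ∧
    (∀ i j, i ≠ j → (T i).verts ∩ (T j).verts = S ∧
      (T i).edgeSet ∩ (T j).edgeSet = ∅)}

/-- `λ(S)`: the largest number of pairwise edge-disjoint trees of `G` each containing `S`. -/
def lambdaSet {V : Type*} (G : SimpleGraph V) (S : Set V) : ℕ :=
  sSup {k | ∃ T : Fin k → G.Subgraph,
    (∀ i, S ⊆ (T i).verts ∧ ((T i).coe).IsTree) ∧
    (∀ i j, i ≠ j → (T i).edgeSet ∩ (T j).edgeSet = ∅)}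

/-- The generalized `r`-connectivity `κ_r(G)`: the minimum of `κ(S)` over `r`-subsets `S`,
and `0` if `G` is disconnected. -/
def genKappa {V : Type*} [Fintype V] (r : ℕ) (G : SimpleGraph V) : ℕ :=
  if G.Connected then
    sInf {k | ∃ S : Finset V, S.card = r ∧ kappaSet G ↑S = k}
  else 0

/-- The generalized `r`-edge-connectivity `λ_r(G)`: the minimum of `λ(S)` over
`r`-subsets `S`, and `0` if `G` is disconnected. -/
def genLambda {V : Type*} [Fintype V] (r : ℕ) (G : SimpleGraph V) : ℕ :=
  if G.Connected then
    sInf {k | ∃ S : Finset V, S.card = r ∧ lambdaSet G ↑S = k}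
  else 0

/-- The vertex connectivity `κ(G)`: the largest `k` such that `G` is `k`-connected,
i.e. `k < |V|` and the removal of fewer than `k` vertices leaves a connected graph. -/
def vertexConnectivity {V : Type*} [Fintype V] (G : SimpleGraph V) : ℕ :=
  sSup {k | k < Fintype.card V ∧
    ∀ S : Finset V, S.card < k → (G.induce ((↑S : Set V)ᶜ)).Connected}

/-- The edge connectivity `λ(G)`: the largest `k` such that removing fewer than `k`
edges always leaves a connected graph. -/
def edgeConnectivity {V : Type*} [Fintype V] (G : SimpleGraph V) : ℕ :=
  sSup {k | ∀ F : Finset (Sym2 V), F.card < k → (G.deleteEdges ↑F).Connected}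

/-- The minimum degree `δ(G)`. -/
def minDeg {V : Type*} [Fintype V] (G : SimpleGraph V) : ℕ :=
  G.minDegree

/-- The number of children of `v` in the graph `H` viewed as rooted at `r`:
neighbours of `v` lying one step further from the root. -/
def childCount {W : Type*} (H : SimpleGraph W) (r v : W) : ℕ :=
  {w | H.Adj v w ∧ H.dist r w = H.dist r v + 1}.ncard

/-- The depth of the graph `H` viewed as rooted at `r`: the largest distance from `r`. -/
def rootedDepth {W : Type*} (H : SimpleGraph W) (r : W) : ℕ :=
  sSup (Set.range (H.dist r))

/-- `T` is a subtree of `G` rooted at `r`, of depth `d`, in which every non-leaf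
vertex has exactly `t` children (a `t`-ary tree of depth `d`). -/
def IsAryTreeOfDepth {V : Type*} {G : SimpleGraph V} (T : G.Subgraph) (r : V)
    (t d : ℕ) : Prop :=
  ∃ hr : r ∈ T.verts,
    T.coe.IsTree ∧ rootedDepth T.coe ⟨r, hr⟩ = d ∧
      ∀ v : T.verts, childCount T.coe ⟨r, hr⟩ v = 0 ∨ childCount T.coe ⟨r, hr⟩ v = t

end

/-! ### Deterministic bounds between the connectivity parameters -/

section Parameters

variable {V : Type*} {G : SimpleGraph V}

/-- In a family of edge-disjoint trees containing two common vertices, the trees use distinct edges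
at each of them. -/
lemma card_le_degree_of_edgeDisjoint_trees [Fintype V] {S : Set V} {v w : V} (hv : v ∈ S)
    (hw : w ∈ S) (hvw : v ≠ w) {k : ℕ} (T : Fin k → G.Subgraph)
    (hT : ∀ i, S ⊆ (T i).verts ∧ ((T i).coe).IsTree)
    (hd : ∀ i j, i ≠ j → (T i).edgeSet ∩ (T j).edgeSet = ∅) : k ≤ G.degree v := by
  have key : ∀ i, ∃ u, (T i).Adj v u := by
    intro i
    have hc : (T i).coe.Connected := (hT i).2.connected
    have : Nontrivial (T i).verts :=
      ⟨⟨v, (hT i).1 hv⟩, ⟨w, (hT i).1 hw⟩, by simpa using hvw⟩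
    obtain ⟨u, hu⟩ := hc.preconnected.exists_adj_of_nontrivial ⟨v, (hT i).1 hv⟩
    exact ⟨u, hu⟩
  choose f hf using key
  have hinj : Function.Injective f := by
    intro i j hij
    by_contra hne
    have h1 : s(v, f i) ∈ (T i).edgeSet ∩ (T j).edgeSet :=
      ⟨hf i, by rw [hij]; exact hf j⟩
    rw [hd i j hne] at h1
    exact h1
  have := Finset.card_le_card_of_injOn (s := Finset.univ) (t := G.neighborFinset v) f
    (fun i _ => by simpa using (hf i).adj_sub) hinj.injOn
  simpa using this

lemma le_lambdaSet_of_edgeDisjoint_trees [Fintype V] {S : Set V} {v w : V} (hv : v ∈ S)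
    (hw : w ∈ S) (hvw : v ≠ w) {k : ℕ} (T : Fin k → G.Subgraph)
    (hT : ∀ i, S ⊆ (T i).verts ∧ ((T i).coe).IsTree)
    (hd : ∀ i j, i ≠ j → (T i).edgeSet ∩ (T j).edgeSet = ∅) : k ≤ lambdaSet G S := by
  refine le_csSup ⟨G.degree v, ?_⟩ ⟨T, hT, hd⟩
  rintro m ⟨T', hT', hd'⟩
  exact card_le_degree_of_edgeDisjoint_trees hv hw hvw T' hT' hd'

lemma lambdaSet_le_degree [Fintype V] {S : Set V} {v w : V} (hv : v ∈ S) (hw : w ∈ S)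
    (hvw : v ≠ w) : lambdaSet G S ≤ G.degree v := by
  refine csSup_le' ?_
  rintro m ⟨T', hT', hd'⟩
  exact card_le_degree_of_edgeDisjoint_trees hv hw hvw T' hT' hd'

lemma kappaSet_le_lambdaSet [Fintype V] {S : Set V} {v w : V} (hv : v ∈ S) (hw : w ∈ S)
    (hvw : v ≠ w) : kappaSet G S ≤ lambdaSet G S := by
  refine csSup_le' ?_
  rintro m ⟨T', hT', hd'⟩
  exact le_lambdaSet_of_edgeDisjoint_trees hv hw hvw T' hT' fun i j hij => (hd' i j hij).2

lemma le_kappaSet [Fintype V] {S : Set V} {v w : V} (hv : v ∈ S) (hw : w ∈ S) (hvw : v ≠ w)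
    {k : ℕ} (T : Fin k → G.Subgraph)
    (hT : ∀ i, S ⊆ (T i).verts ∧ ((T i).coe).IsTree)
    (hd : ∀ i j, i ≠ j → (T i).verts ∩ (T j).verts = S ∧ (T i).edgeSet ∩ (T j).edgeSet = ∅) :
    k ≤ kappaSet G S := by
  refine le_csSup ⟨G.degree v, ?_⟩ ⟨T, hT, hd⟩
  rintro m ⟨T', hT', hd'⟩
  exact card_le_degree_of_edgeDisjoint_trees hv hw hvw T' hT' fun i j hij => (hd' i j hij).2

lemma exists_pair_of_two_le_card {S : Finset V} (hS : 2 ≤ S.card) (v : V) :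
    ∃ w ∈ S, v ≠ w := by
  obtain ⟨w, hw, hne⟩ := Finset.exists_mem_ne (s := S) (by omega) v
  exact ⟨w, hw, hne.symm⟩

lemma genKappa_le_genLambda [Fintype V] {r : ℕ} (hr : 2 ≤ r) (hV : r ≤ Fintype.card V) :
    genKappa r G ≤ genLambda r G := by
  unfold genKappa genLambda
  split_ifs with hc
  · obtain ⟨S₀, -, hS₀⟩ := Finset.exists_subset_card_eq (s := (Finset.univ : Finset V))
      (by simpa using hV)
    refine le_csInf ⟨_, S₀, hS₀, rfl⟩ ?_
    rintro _ ⟨S, hS, rfl⟩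
    obtain ⟨v, hv⟩ := Finset.card_pos.1 (by omega : 0 < S.card)
    obtain ⟨w, hw, hvw⟩ := exists_pair_of_two_le_card (S := S) (by omega) v
    exact le_trans (Nat.sInf_le ⟨S, hS, rfl⟩)
      (kappaSet_le_lambdaSet (Finset.mem_coe.2 hv) (Finset.mem_coe.2 hw) hvw)
  · exact le_rfl

lemma genLambda_le_minDeg [Fintype V] {r : ℕ} (hr : 2 ≤ r) (hV : r ≤ Fintype.card V) :
    genLambda r G ≤ minDeg G := by
  unfold genLambda
  split_ifs with hc
  · have : Nonempty V := Fintype.card_pos_iff.1 (by omega)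
    obtain ⟨v, hv⟩ := G.exists_minimal_degree_vertex
    obtain ⟨S, hvS, -, hS⟩ := Finset.exists_subsuperset_card_eq (s := {v})
      (Finset.subset_univ _) (n := r) (by simp; omega) (by simpa using hV)
    have hv' : v ∈ S := hvS (by simp)
    obtain ⟨w, hw, hvw⟩ := exists_pair_of_two_le_card (S := S) (by omega) v
    refine le_trans (Nat.sInf_le ⟨S, hS, rfl⟩) ?_
    rw [minDeg, hv]
    exact lambdaSet_le_degree (Finset.mem_coe.2 hv') (Finset.mem_coe.2 hw) hvw
  · exact Nat.zero_le _

lemma connected_le_minDeg_of_deleteVerts [Fintype V] [Nonempty V] {k : ℕ}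
    (hk : k < Fintype.card V)
    (h : ∀ S : Finset V, S.card < k → (G.induce ((↑S : Set V)ᶜ)).Connected) : k ≤ minDeg G := by
  by_contra! hlt
  obtain ⟨v, hv⟩ := G.exists_minimal_degree_vertex
  rw [minDeg, hv] at hlt
  have hc := h (G.neighborFinset v) (by simpa using hlt)
  have hcard : (insert v (G.neighborFinset v)).card < Fintype.card V := by
    have := Finset.card_insert_le v (G.neighborFinset v)
    simp only [SimpleGraph.card_neighborFinset_eq_degree] at this
    omega
  obtain ⟨w, hw⟩ : ∃ w, w ∉ insert v (G.neighborFinset v) := by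
    by_contra! hall
    rw [Finset.eq_univ_iff_forall.2 hall] at hcard
    simp at hcard
  simp only [Finset.mem_insert, SimpleGraph.mem_neighborFinset, not_or] at hw
  have : Nontrivial ↑((↑(G.neighborFinset v) : Set V)ᶜ) :=
    ⟨⟨v, by simp⟩, ⟨w, by simpa using hw.2⟩, by simpa using fun h => hw.1 h.symm⟩
  obtain ⟨u, hu⟩ := hc.preconnected.exists_adj_of_nontrivial ⟨v, by simp⟩
  have h1 : G.Adj v u := hu
  have h2 := u.2
  simp at h2
  exact h2 h1

lemma le_vertexConnectivity [Fintype V] [Nonempty V] {k : ℕ} (hk : k < Fintype.card V)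
    (h : ∀ S : Finset V, S.card < k → (G.induce ((↑S : Set V)ᶜ)).Connected) :
    k ≤ vertexConnectivity G :=
  le_csSup ⟨minDeg G, fun _ hk => connected_le_minDeg_of_deleteVerts hk.1 hk.2⟩ ⟨hk, h⟩

lemma le_minDeg_of_deleteEdges [Fintype V] [Nontrivial V] {k : ℕ}
    (h : ∀ F : Finset (Sym2 V), F.card < k → (G.deleteEdges ↑F).Connected) : k ≤ minDeg G := by
  by_contra! hlt
  obtain ⟨v, hv⟩ := G.exists_minimal_degree_vertex
  rw [minDeg, hv] at hlt
  have hc := h (G.incidenceFinset v) (by simpa using hlt)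
  obtain ⟨u, hu⟩ := hc.preconnected.exists_adj_of_nontrivial v
  rw [SimpleGraph.deleteEdges_adj] at hu
  exact hu.2 (by simpa using hu.1)

lemma edgeConnectivity_le_minDeg [Fintype V] [Nontrivial V] : edgeConnectivity G ≤ minDeg G :=
  csSup_le' fun _ hk => le_minDeg_of_deleteEdges hk

lemma le_edgeConnectivity [Fintype V] [Nontrivial V] {k : ℕ}
    (h : ∀ F : Finset (Sym2 V), F.card < k → (G.deleteEdges ↑F).Connected) :
    k ≤ edgeConnectivity G :=
  le_csSup ⟨minDeg G, fun _ hk => le_minDeg_of_deleteEdges hk⟩ h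

lemma mem_vertexConnectivity_set [Fintype V] [Nonempty V] :
    vertexConnectivity G < Fintype.card V ∧
      ∀ S : Finset V, S.card < vertexConnectivity G → (G.induce ((↑S : Set V)ᶜ)).Connected :=
  Nat.sSup_mem (s := {k | k < Fintype.card V ∧
      ∀ S : Finset V, S.card < k → (G.induce ((↑S : Set V)ᶜ)).Connected})
    ⟨0, Fintype.card_pos, fun _ h => absurd h (Nat.not_lt_zero _)⟩
    ⟨minDeg G, fun _ hk => connected_le_minDeg_of_deleteVerts hk.1 hk.2⟩

/-- Deleting one edge costs at most one unit of vertex connectivity. -/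
lemma connected_induce_deleteEdges_singleton [Fintype V] {k : ℕ} (hk : k + 1 < Fintype.card V)
    (h : ∀ S : Finset V, S.card < k + 1 → (G.induce ((↑S : Set V)ᶜ)).Connected) (e : Sym2 V)
    (S : Finset V) (hS : S.card < k) :
    ((G.deleteEdges {e}).induce ((↑S : Set V)ᶜ)).Connected := by
  induction e using Sym2.ind with
  | _ a b =>
  have hmono : ∀ c : V, (c = a ∨ c = b) → ∀ x y : V,
      ∀ (hx : x ∉ insert c S) (hy : y ∉ insert c S),
      ((G.deleteEdges {s(a, b)}).induce ((↑S : Set V)ᶜ)).Reachable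
        ⟨x, by simp at hx ⊢; tauto⟩ ⟨y, by simp at hy ⊢; tauto⟩ := by
    intro c hc x y hx hy
    have hcon := h (insert c S) ((Finset.card_insert_le _ _).trans_lt (by omega))
    obtain ⟨w⟩ := hcon.preconnected ⟨x, by simpa using hx⟩ ⟨y, by simpa using hy⟩
    let φ : G.induce ((↑(insert c S) : Set V)ᶜ) →g
        (G.deleteEdges {s(a, b)}).induce ((↑S : Set V)ᶜ) :=
      { toFun := fun z => ⟨z.1, by have := z.2; simp at this ⊢; tauto⟩
        map_rel' := by
          rintro ⟨z, hz⟩ ⟨z', hz'⟩ hzz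
          have h1 : G.Adj z z' := hzz
          simp only [SimpleGraph.comap_adj, Function.Embedding.subtype_apply,
            SimpleGraph.deleteEdges_adj, Set.mem_singleton_iff, Sym2.eq_iff]
          refine ⟨h1, ?_⟩
          simp only [Finset.coe_insert, Set.mem_compl_iff, Set.mem_insert_iff, not_or] at hz hz'
          rcases hc with rfl | rfl
          · rintro (⟨h, -⟩ | ⟨-, h⟩)
            exacts [hz.1 h, hz'.1 h]
          · rintro (⟨-, h⟩ | ⟨h, -⟩)
            exacts [hz'.1 h, hz.1 h] }
    exact ⟨w.map φ⟩
  obtain ⟨c, hc⟩ : ∃ c, c ∉ insert a (insert b S) := by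
    by_contra! hall
    have h1 := Finset.card_le_two (a := a) (b := b)
    have h2 := Finset.card_insert_le a (insert b S)
    have h3 := Finset.card_insert_le b S
    rw [Finset.eq_univ_iff_forall.2 hall, Finset.card_univ] at h2
    omega
  simp only [Finset.mem_insert, not_or] at hc
  have hcS : c ∈ ((↑S : Set V)ᶜ) := by simpa using hc.2.2
  rw [SimpleGraph.connected_iff_exists_forall_reachable]
  refine ⟨⟨c, hcS⟩, ?_⟩
  rintro ⟨x, hx⟩
  by_cases hxa : x = a
  · subst hxa
    by_cases hab : x = b
    · subst hab
      have h1 : G.deleteEdges {s(x, x)} = G := by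
        ext y z
        simp only [SimpleGraph.deleteEdges_adj, Set.mem_singleton_iff, Sym2.eq_iff]
        refine ⟨fun h => h.1, fun h => ⟨h, ?_⟩⟩
        rintro (⟨rfl, rfl⟩ | ⟨rfl, rfl⟩) <;> exact h.ne rfl
      rw [h1]
      exact (h S (by omega)).preconnected _ _
    · exact hmono b (Or.inr rfl) c x (by simp [hc]) (by simp at hx ⊢; exact ⟨hab, hx⟩)
  · exact hmono a (Or.inl rfl) c x (by simp [hc]) (by simp at hx ⊢; exact ⟨hxa, hx⟩)

lemma connected_induce_deleteEdges [Fintype V] (F : Finset (Sym2 V)) :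
    ∀ {k : ℕ}, k + F.card < Fintype.card V →
    (∀ S : Finset V, S.card < k + F.card → (G.induce ((↑S : Set V)ᶜ)).Connected) →
    ∀ S : Finset V, S.card < k → ((G.deleteEdges ↑F).induce ((↑S : Set V)ᶜ)).Connected := by
  induction F using Finset.induction_on with
  | empty => intro k _ h S hS; simpa using h S (by simpa using hS)
  | insert e F he ih =>
    intro k hk h
    rw [Finset.card_insert_of_notMem he] at hk h
    have := ih (k := k + 1) (by omega) (fun S hS => h S (by omega))
    intro S hS
    have h2 := connected_induce_deleteEdges_singleton (by omega) this e S hS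
    rw [SimpleGraph.deleteEdges_deleteEdges] at h2
    convert h2 using 3
    ext; simp

lemma vertexConnectivity_le_edgeConnectivity [Fintype V] [Nontrivial V] :
    vertexConnectivity G ≤ edgeConnectivity G := by
  refine le_edgeConnectivity fun F hF => ?_
  have h := mem_vertexConnectivity_set (G := G)
  have h2 := connected_induce_deleteEdges F (G := G) (k := vertexConnectivity G - F.card)
    (by omega) (fun S hS => h.2 S (by omega)) ∅ (by simp; omega)
  have e : ((↑(∅ : Finset V) : Set V)ᶜ) = Set.univ := by simp
  rw [e] at h2
  exact (SimpleGraph.Iso.connected_iff (SimpleGraph.induceUnivIso _)).1 h2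

end Parameters

/-! ### Internally disjoint trees from disjoint connected sets -/

section Trees

variable {V : Type*} {G : SimpleGraph V}

lemma exists_isTree_subgraph_le {H : G.Subgraph} (hH : H.coe.Connected) :
    ∃ T : G.Subgraph, T.verts = H.verts ∧ T ≤ H ∧ T.coe.IsTree := by
  obtain ⟨T, hle, hT⟩ := hH.exists_isTree_le
  refine ⟨{ verts := H.verts
            Adj := fun a b => ∃ (ha : a ∈ H.verts) (hb : b ∈ H.verts), T.Adj ⟨a, ha⟩ ⟨b, hb⟩
            adj_sub := ?_, edge_vert := ?_, symm := ?_ }, rfl, ⟨le_rfl, ?_⟩, ?_⟩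
  · rintro a b ⟨ha, hb, h⟩
    exact (hle h : H.Adj a b).adj_sub
  · rintro a b ⟨ha, hb, h⟩
    exact ha
  · refine ⟨?_⟩
    rintro a b ⟨ha, hb, h⟩
    exact ⟨hb, ha, h.symm⟩
  · rintro a b ⟨ha, hb, h⟩
    exact hle h
  · convert hT
    ext ⟨a, ha⟩ ⟨b, hb⟩
    exact ⟨fun ⟨_, _, h⟩ => h, fun h => ⟨ha, hb, h⟩⟩

lemma induce_connected_of_eq {s t : Set V} (h : (G.induce s).Connected) (hst : s = t) :
    (G.induce t).Connected := hst ▸ h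

lemma induce_singleton_connected (v : V) : (G.induce {v}).Connected := by
  rw [SimpleGraph.induce_singleton_eq_top]
  exact SimpleGraph.connected_top

/-- A family of connected subgraphs meeting exactly in `S` yields as many disjoint trees. -/
lemma card_le_kappaSet [Fintype V] {S : Set V} {v w : V} (hv : v ∈ S) (hw : w ∈ S)
    (hvw : v ≠ w) {ι : Type*} [Fintype ι] (H : ι → G.Subgraph)
    (hc : ∀ i, (H i).coe.Connected) (hS : ∀ i, S ⊆ (H i).verts)
    (hd : ∀ i j, i ≠ j → (H i).verts ∩ (H j).verts ⊆ S)
    (he : ∀ i j, i ≠ j → ∀ a b, (H i).Adj a b → ¬ (H j).Adj a b) :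
    Fintype.card ι ≤ kappaSet G S := by
  choose T hTv hTle hT using fun i => exists_isTree_subgraph_le (hc i)
  let e := (Fintype.equivFin ι).symm
  refine le_kappaSet hv hw hvw (fun i => T (e i)) (fun i => ⟨?_, hT _⟩) fun i j hij => ⟨?_, ?_⟩
  · rw [hTv]; exact hS _
  · simp only [hTv]
    exact (hd _ _ (e.injective.ne hij)).antisymm (Set.subset_inter (hS _) (hS _))
  · rw [Set.eq_empty_iff_forall_notMem]
    intro x
    induction x using Sym2.ind with
    | _ a b =>
    rintro ⟨h1, h2⟩
    exact he _ _ (e.injective.ne hij) a b ((hTle _).2 h1) ((hTle _).2 h2)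

/-- The subgraph on `C ∪ S` consisting of all edges of `G` within it that meet `C`. -/
def hubSubgraph (G : SimpleGraph V) (C S : Set V) : G.Subgraph where
  verts := C ∪ S
  Adj a b := G.Adj a b ∧ a ∈ C ∪ S ∧ b ∈ C ∪ S ∧ (a ∈ C ∨ b ∈ C)
  adj_sub h := h.1
  edge_vert h := h.2.1
  symm := ⟨fun _ _ h => ⟨h.1.symm, h.2.2.1, h.2.1, h.2.2.2.symm⟩⟩

lemma hubSubgraph_connected {C S : Set V} (hC : (G.induce C).Connected)
    (hS : ∀ s ∈ S, ∃ c ∈ C, G.Adj s c) : (hubSubgraph G C S).coe.Connected := by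
  obtain ⟨c₀⟩ := hC.nonempty
  let φ : G.induce C →g (hubSubgraph G C S).coe :=
    { toFun := fun c => ⟨c.1, Or.inl c.2⟩
      map_rel' := fun {a b} h => ⟨h, Or.inl a.2, Or.inl b.2, Or.inl a.2⟩ }
  have key : ∀ c, (hubSubgraph G C S).coe.Reachable (φ c₀) (φ c) := fun c =>
    (hC.preconnected c₀ c).map φ
  rw [SimpleGraph.connected_iff_exists_forall_reachable]
  refine ⟨φ c₀, ?_⟩
  rintro ⟨x, hx | hx⟩
  · exact key ⟨x, hx⟩
  · obtain ⟨c, hc, hxc⟩ := hS x hx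
    refine (key ⟨c, hc⟩).trans (SimpleGraph.Adj.reachable ?_)
    exact ⟨hxc.symm, Or.inl hc, Or.inr hx, Or.inl hc⟩

lemma hubSubgraph_verts_inter {C C' S : Set V} (h : Disjoint C C') :
    (hubSubgraph G C S).verts ∩ (hubSubgraph G C' S).verts ⊆ S := by
  rintro x ⟨h1 | h1, h2 | h2⟩
  · exact absurd h2 (Set.disjoint_left.1 h h1)
  all_goals assumption

lemma hubSubgraph_not_adj {C C' S : Set V} (h : Disjoint C C') (hS : Disjoint C S) (a b : V)
    (hab : (hubSubgraph G C S).Adj a b) : ¬ (hubSubgraph G C' S).Adj a b := by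
  rintro ⟨-, ha, hb, -⟩
  rcases hab.2.2.2 with hC | hC
  · exact ha.elim (Set.disjoint_left.1 h hC) (Set.disjoint_left.1 hS hC)
  · exact hb.elim (Set.disjoint_left.1 h hC) (Set.disjoint_left.1 hS hC)

lemma card_le_kappaSet_of_hubs [Fintype V] {S : Set V} {v w : V} (hv : v ∈ S) (hw : w ∈ S)
    (hvw : v ≠ w) {r : ℕ} (C : Fin r → Set V) (hC : ∀ i, (G.induce (C i)).Connected)
    (hS : ∀ i, ∀ s ∈ S, ∃ c ∈ C i, G.Adj s c) (hdS : ∀ i, Disjoint (C i) S)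
    (hd : ∀ i j, i ≠ j → Disjoint (C i) (C j)) : r ≤ kappaSet G S := by
  have := card_le_kappaSet hv hw hvw (fun i => hubSubgraph G (C i) S)
    (fun i => hubSubgraph_connected (hC i) (hS i)) (fun i => Set.subset_union_right)
    (fun i j hij => hubSubgraph_verts_inter (hd i j hij))
    (fun i j hij => hubSubgraph_not_adj (hd i j hij) (hdS i))
  simpa using this

/-- If `S` itself induces a connected graph, one further tree lives on `S`. -/
lemma succ_le_kappaSet_of_hubs [Fintype V] {S : Set V} {v w : V} (hv : v ∈ S) (hw : w ∈ S)
    (hvw : v ≠ w) {r : ℕ} (C : Fin r → Set V) (hC : ∀ i, (G.induce (C i)).Connected)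
    (hS : ∀ i, ∀ s ∈ S, ∃ c ∈ C i, G.Adj s c) (hdS : ∀ i, Disjoint (C i) S)
    (hd : ∀ i j, i ≠ j → Disjoint (C i) (C j)) (hSc : (G.induce S).Connected) :
    r + 1 ≤ kappaSet G S := by
  have hcross : ∀ i a b, (hubSubgraph G (C i) S).Adj a b →
      ¬ ((⊤ : G.Subgraph).induce S).Adj a b := by
    rintro i a b h ⟨ha, hb, -⟩
    rcases h.2.2.2 with h | h
    · exact Set.disjoint_left.1 (hdS i) h ha
    · exact Set.disjoint_left.1 (hdS i) h hb
  have := card_le_kappaSet hv hw hvw (ι := Option (Fin r)) (fun o => match o with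
      | none => (⊤ : G.Subgraph).induce S
      | some i => hubSubgraph G (C i) S) ?_ ?_ ?_ ?_
  · simpa using this
  · rintro (_ | i)
    · exact SimpleGraph.Subgraph.connected_iff'.1 (SimpleGraph.connected_induce_iff.1 hSc)
    · exact hubSubgraph_connected (hC i) (hS i)
  · rintro (_ | i)
    · exact le_rfl
    · exact Set.subset_union_right
  · rintro (_ | i) (_ | j) hij
    · exact absurd rfl hij
    · exact Set.inter_subset_left
    · exact Set.inter_subset_right
    · exact hubSubgraph_verts_inter (hd i j fun h => hij (by rw [h]))
  · rintro (_ | i) (_ | j) hij a b h h'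
    · exact hij rfl
    · exact hcross j a b h' h
    · exact hcross i a b h h'
    · exact hubSubgraph_not_adj (hd i j fun h => hij (by rw [h])) (hdS i) a b h h'

lemma insert_connected {C : Set V} (hC : (G.induce C).Connected) {x y : V} (hy : y ∈ C)
    (hxy : G.Adj x y) : (G.induce (insert x C)).Connected :=
  induce_connected_of_eq (SimpleGraph.connected_induce_union
    (induce_singleton_connected (G := G) x).preconnected hC.preconnected (Set.mem_singleton x) hy
    hxy) (by simp)

/-- Distinct representatives for the neighbourhoods of three vertices. -/
lemma exists_injective_representatives {r : ℕ} (P : Fin 3 → Finset V) (hP : ∀ i, r ≤ (P i).card)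
    (hdis : ∀ i j, i ≠ j → (P i).card < 3 * r → (P j).card < 3 * r → Disjoint (P i) (P j)) :
    ∃ x : Fin 3 × Fin r → V, Function.Injective x ∧ ∀ q, x q ∈ P q.1 := by
  refine (Finset.all_card_le_biUnion_card_iff_exists_injective (fun q : Fin 3 × Fin r => P q.1)).1 ?_
  intro J
  by_cases hbig : ∃ q ∈ J, 3 * r ≤ (P q.1).card
  · obtain ⟨q, hq, hle⟩ := hbig
    calc J.card ≤ Fintype.card (Fin 3 × Fin r) := Finset.card_le_univ J
      _ = 3 * r := by simp
      _ ≤ _ := hle.trans (Finset.card_le_card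
        (Finset.subset_biUnion_of_mem (fun q : Fin 3 × Fin r => P q.1) hq))
  · push Not at hbig
    have h1 : J.card ≤ (J.image Prod.fst).card * r := by
      have : J ⊆ (J.image Prod.fst) ×ˢ Finset.univ := fun q hq => by
        simp only [Finset.mem_product, Finset.mem_image, Finset.mem_univ, and_true]
        exact ⟨q, hq, rfl⟩
      simpa using Finset.card_le_card this
    have h2 : J.biUnion (fun q => P q.1) = (J.image Prod.fst).biUnion P := by
      rw [Finset.image_biUnion]
    rw [h2, Finset.card_biUnion]
    · refine h1.trans ?_
      rw [← smul_eq_mul]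
      exact Finset.card_nsmul_le_sum _ _ _ fun i _ => hP i
    · intro i hi j hj hij
      obtain ⟨q, hq, rfl⟩ := Finset.mem_image.1 hi
      obtain ⟨q', hq', rfl⟩ := Finset.mem_image.1 hj
      exact hdis _ _ hij (hbig q hq) (hbig q' hq')

end Trees

/-! ### Growing disjoint connected sets in an expanding graph -/

/-- The pseudorandom properties used below: vertices of degree below `L` are at distance at least
three from each other, small vertex sets span few edges, medium vertex sets expand by a factor `K`,
and any two disjoint sets of size `m` are joined by an edge. -/
structure IsExpanding {V : Type*} [Fintype V] (G : SimpleGraph V) (L K b m : ℕ) : Prop where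
  not_adj : ∀ u v, G.degree u < L → G.degree v < L → ¬ G.Adj u v
  not_common : ∀ u v z, u ≠ v → G.degree u < L → G.degree v < L → G.Adj u z → ¬ G.Adj v z
  sparse : ∀ B : Finset V, B.Nonempty → B.card ≤ b →
    ∀ F : Finset (Sym2 V), F ⊆ B.sym2 → F ⊆ G.edgeFinset → F.card ≠ 2 * B.card
  expand : ∀ A T : Finset V, b < (K + 1) * A.card → A.card ≤ m → T.card = K * A.card →
    ∃ x ∈ A, ∃ y, y ∉ A ∧ y ∉ T ∧ G.Adj x y
  joined : ∀ A B : Finset V, A.card = m → B.card = m → Disjoint A B →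
    ∃ x ∈ A, ∃ y ∈ B, G.Adj x y

section Growth

variable {V : Type*} [Fintype V] {G : SimpleGraph V} {L K b m : ℕ}

/-- If the small-degree vertices of `A` all have a neighbour in `A` and `A` has all its neighbours
in `B`, then `B` spans many edges. -/
lemma exists_edges_of_closed_neighborhood (hG : IsExpanding G L K b m) {A B : Finset V}
    (hAB : A ⊆ B) (hA : ∀ a ∈ A, G.degree a < L → ∃ a' ∈ A, G.Adj a a')
    (hN : ∀ a ∈ A, ∀ y, G.Adj a y → y ∈ B) :
    ∃ F : Finset (Sym2 V), F ⊆ B.sym2 ∧ F ⊆ G.edgeFinset ∧ L * A.card ≤ 4 * F.card := by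
  set A' := A.filter (fun a => ¬ G.degree a < L) with hA'
  have hcard : A.card ≤ 2 * A'.card := by
    have h1 : (A.filter (fun a => G.degree a < L)).card ≤ A'.card := by
      choose! f hfA hf using hA
      refine Finset.card_le_card_of_injOn f ?_ ?_
      · intro a ha
        simp only [Finset.coe_filter, Set.mem_ofPred_eq] at ha
        simp only [hA', Finset.coe_filter, Set.mem_ofPred_eq]
        exact ⟨hfA a ha.1 ha.2, fun h => hG.not_adj a _ ha.2 h (hf a ha.1 ha.2)⟩
      · intro a ha a' ha' h
        simp only [Finset.coe_filter, Set.mem_ofPred_eq] at ha ha'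
        by_contra hne
        exact hG.not_common a a' (f a) hne ha.2 ha'.2 (hf a ha.1 ha.2)
          (by rw [h]; exact hf a' ha'.1 ha'.2)
    have := Finset.card_filter_add_card_filter_not (s := A) (fun a => G.degree a < L)
    simp only [hA'] at h1 ⊢
    omega
  set P := A'.sigma (fun a => G.neighborFinset a) with hP
  have hPcard : L * A'.card ≤ P.card := by
    rw [hP, Finset.card_sigma, mul_comm, ← smul_eq_mul]
    refine Finset.card_nsmul_le_sum _ _ _ fun a ha => ?_
    rw [SimpleGraph.card_neighborFinset_eq_degree]
    exact not_lt.1 (Finset.mem_filter.1 ha).2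
  refine ⟨P.image (fun q => s(q.1, q.2)), ?_, ?_, ?_⟩
  · intro e he
    obtain ⟨⟨a, y⟩, h, rfl⟩ := Finset.mem_image.1 he
    simp only [hP, Finset.mem_sigma, SimpleGraph.mem_neighborFinset] at h
    have ha := (Finset.mem_filter.1 h.1).1
    simpa using ⟨hAB ha, hN a ha y h.2⟩
  · intro e he
    obtain ⟨⟨a, y⟩, h, rfl⟩ := Finset.mem_image.1 he
    simp only [hP, Finset.mem_sigma, SimpleGraph.mem_neighborFinset] at h
    simpa using h.2
  · have h2 : P.card ≤ 2 * (P.image (fun q => s(q.1, q.2))).card := by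
      refine Finset.card_le_mul_card_image _ _ ?_
      intro e he
      induction e using Sym2.ind with
      | _ x y =>
      refine (Finset.card_le_card (t := {⟨x, y⟩, ⟨y, x⟩}) ?_).trans Finset.card_le_two
      rintro ⟨p, q⟩ h
      have := (Finset.mem_filter.1 h).2
      simp only [Sym2.eq_iff] at this
      rcases this with ⟨rfl, rfl⟩ | ⟨rfl, rfl⟩ <;> simp
    nlinarith

lemma IsExpanding.exists_adj_notMem (hG : IsExpanding G L K b m) (hL : 8 * (K + 1) ≤ L)
    (hm : (K + 1) * m ≤ Fintype.card V) {A T : Finset V} (hne : A.Nonempty) (hAm : A.card ≤ m)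
    (hA : ∀ a ∈ A, G.degree a < L → ∃ a' ∈ A, G.Adj a a') (hT : T.card ≤ K * A.card) :
    ∃ x ∈ A, ∃ y, y ∉ A ∧ y ∉ T ∧ G.Adj x y := by
  rcases lt_or_ge b ((K + 1) * A.card) with h | h
  · obtain ⟨T', hTT', -, hT'⟩ := Finset.exists_subsuperset_card_eq (Finset.subset_univ T) hT
      (by rw [Finset.card_univ]; nlinarith)
    obtain ⟨x, hx, y, hy, hyT, hxy⟩ := hG.expand A T' h hAm hT'
    exact ⟨x, hx, y, hy, fun h => hyT (hTT' h), hxy⟩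
  · by_contra! hcon
    obtain ⟨F, hF1, hF2, hF3⟩ := exists_edges_of_closed_neighborhood hG
      (Finset.subset_union_left (s₂ := T)) hA (fun a ha y hay => by
        by_contra hy
        rw [Finset.mem_union, not_or] at hy
        exact hcon a ha y hy.1 hy.2 hay)
    have hB : (A ∪ T).card ≤ (K + 1) * A.card := by
      have := Finset.card_union_le A T
      linarith
    have h4 : 2 * (A ∪ T).card ≤ F.card := by nlinarith
    obtain ⟨F', hF'F, hF'⟩ := Finset.exists_subset_card_eq h4
    exact hG.sparse _ (hne.mono Finset.subset_union_left) (hB.trans h) F' (hF'F.trans hF1)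
      (hF'F.trans hF2) hF'

/-- Starting from distinct vertices of large degree outside `X`, disjoint connected sets of any
size up to `m` can be grown avoiding `X`. -/
lemma IsExpanding.exists_grown (hG : IsExpanding G L K b m) (hL : 8 * (K + 1) ≤ L)
    (hm : (K + 1) * m ≤ Fintype.card V) {ι : Type*} [Fintype ι] (x : ι → V)
    (hx : Function.Injective x) (X : Finset V) (hxX : ∀ i, x i ∉ X)
    (hxL : ∀ i, ¬ G.degree (x i) < L) (hK : X.card + 2 * Fintype.card ι ≤ K) {t : ℕ}
    (ht : 1 ≤ t) (htm : t ≤ m) :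
    ∃ C : ι → Finset V, (∀ i, x i ∈ C i) ∧ (∀ i, (C i).card = t) ∧
      (∀ i j, i ≠ j → Disjoint (C i) (C j)) ∧ (∀ i, Disjoint (C i) X) ∧
      ∀ i, (G.induce (↑(C i) : Set V)).Connected := by
  induction t, ht using Nat.le_induction with
  | base =>
    refine ⟨fun i => {x i}, by simp, by simp, ?_, by simpa using hxX, fun i => ?_⟩
    · intro i j hij
      simpa using hx.ne hij
    · exact induce_connected_of_eq (induce_singleton_connected (x i)) (by simp)
  | succ t ht ih =>
    have step : ∀ J : Finset ι, ∃ C : ι → Finset V, (∀ i, x i ∈ C i) ∧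
        (∀ i, (C i).card = if i ∈ J then t + 1 else t) ∧
        (∀ i j, i ≠ j → Disjoint (C i) (C j)) ∧ (∀ i, Disjoint (C i) X) ∧
        ∀ i, (G.induce (↑(C i) : Set V)).Connected := by
      intro J
      induction J using Finset.induction_on with
      | empty => simpa using ih (by omega)
      | insert j J hj ihJ =>
        obtain ⟨C, h1, h2, h3, h4, h5⟩ := ihJ
        have hCj : (C j).card = t := by simpa [hj] using h2 j
        have hsmall : ∀ a ∈ C j, G.degree a < L → ∃ a' ∈ C j, G.Adj a a' := by
          intro a ha hdeg
          have hne : x j ≠ a := by rintro rfl; exact hxL j hdeg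
          have : Nontrivial (↑(C j) : Set V) := ⟨⟨a, ha⟩, ⟨x j, h1 j⟩, by simpa using hne.symm⟩
          obtain ⟨⟨a', ha'⟩, hadj⟩ := (h5 j).preconnected.exists_adj_of_nontrivial ⟨a, ha⟩
          exact ⟨a', ha', hadj⟩
        have hT : (X ∪ Finset.univ.biUnion C).card ≤ K * (C j).card := by
          have hb : (Finset.univ.biUnion C).card ≤ Fintype.card ι * (t + 1) := by
            refine Finset.card_biUnion_le.trans ?_
            rw [← Finset.card_univ, ← smul_eq_mul]
            refine Finset.sum_le_card_nsmul _ _ _ fun i _ => ?_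
            rw [h2]; split_ifs <;> omega
          have := Finset.card_union_le X (Finset.univ.biUnion C)
          rw [hCj]
          nlinarith
        obtain ⟨a, ha, y, hy, hyT, hay⟩ := hG.exists_adj_notMem hL hm ⟨x j, h1 j⟩
          (by omega) hsmall hT
        simp only [Finset.mem_union, Finset.mem_biUnion, Finset.mem_univ, true_and, not_or,
          not_exists] at hyT
        refine ⟨Function.update C j (insert y (C j)), ?_, ?_, ?_, ?_, ?_⟩
        · intro i
          by_cases hi : i = j
          · subst hi; simp [h1]
          · simp [hi, h1]
        · intro i
          by_cases hi : i = j
          · subst hi; simp [hy, hCj]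
          · simp [hi, h2]
        · intro i i' hii
          by_cases hi : i = j
          · subst hi
            simp [hii.symm, hyT.2, h3 _ _ hii]
          · by_cases hi' : i' = j
            · subst hi'
              simp [hii, hyT.2, h3 _ _ hii]
            · simp [hi, hi', h3 _ _ hii]
        · intro i
          by_cases hi : i = j
          · subst hi; simp [hyT.1, h4]
          · simp [hi, h4]
        · intro i
          by_cases hi : i = j
          · subst hi
            have := SimpleGraph.connected_induce_union (h5 i).preconnected
              (induce_singleton_connected (G := G) y).preconnected
              (Finset.mem_coe.2 ha) (Set.mem_singleton y) hay
            exact induce_connected_of_eq this (by simp)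
          · exact induce_connected_of_eq (h5 i) (by simp [hi])
    simpa using step Finset.univ

end Growth

/-! ### Connectivity of expanding graphs -/

section Expanding

variable {V : Type*} [Fintype V] {G : SimpleGraph V} {L K b m D : ℕ}

/-- The neighbours of `x` of degree at least `L`. -/
noncomputable def largeNeighbors (G : SimpleGraph V) (L : ℕ) (x : V) : Finset V :=
  (G.neighborFinset x).filter (fun y => ¬ G.degree y < L)

lemma mem_largeNeighbors {x y : V} :
    y ∈ largeNeighbors G L x ↔ G.Adj x y ∧ ¬ G.degree y < L := by
  simp [largeNeighbors]

lemma IsExpanding.largeNeighbors_of_degree_lt (hG : IsExpanding G L K b m) {x : V}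
    (hx : G.degree x < L) : largeNeighbors G L x = G.neighborFinset x := by
  refine Finset.filter_true_of_mem fun y hy h => ?_
  exact hG.not_adj x y hx h (by simpa using hy)

lemma IsExpanding.card_largeNeighbors_of_le_degree (hG : IsExpanding G L K b m) {x : V}
    (hx : ¬ G.degree x < L) : L ≤ (largeNeighbors G L x).card + 1 := by
  have h1 : ((G.neighborFinset x).filter (fun y => G.degree y < L)).card ≤ 1 := by
    rw [Finset.card_le_one]
    intro y hy z hz
    simp only [Finset.mem_filter, SimpleGraph.mem_neighborFinset] at hy hz
    by_contra hne
    exact hG.not_common y z x hne hy.2 hz.2 hy.1.symm hz.1.symm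
  have h2 := Finset.card_filter_add_card_filter_not (s := G.neighborFinset x)
    (fun y => G.degree y < L)
  rw [SimpleGraph.card_neighborFinset_eq_degree] at h2
  unfold largeNeighbors
  omega

lemma IsExpanding.union_connected (hG : IsExpanding G L K b m) {A B : Finset V}
    (hA : A.card = m) (hB : B.card = m) (hAc : (G.induce (↑A : Set V)).Connected)
    (hBc : (G.induce (↑B : Set V)).Connected) : (G.induce (↑A ∪ ↑B : Set V)).Connected := by
  by_cases h : Disjoint A B
  · obtain ⟨x, hx, y, hy, hxy⟩ := hG.joined A B hA hB h
    exact SimpleGraph.connected_induce_union hAc.preconnected hBc.preconnected hx hy hxy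
  · rw [Finset.not_disjoint_iff] at h
    obtain ⟨x, hx, hx'⟩ := h
    exact SimpleGraph.induce_union_connected hAc.preconnected hBc.preconnected ⟨x, hx, hx'⟩

lemma IsExpanding.connected_deleteVerts (hG : IsExpanding G L K b m) (hL : 8 * (K + 1) ≤ L)
    (hm : (K + 1) * m ≤ Fintype.card V) (hm1 : 1 ≤ m) (hK : minDeg G + 2 ≤ K)
    (hV : minDeg G < Fintype.card V) (Y : Finset V) (hY : Y.card < minDeg G) :
    (G.induce ((↑Y : Set V)ᶜ)).Connected := by
  have key : ∀ u ∉ Y, ∃ C : Finset V, C.card = m ∧ Disjoint C Y ∧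
      (G.induce (↑C : Set V)).Connected ∧ ∃ y ∈ C, G.Adj u y := by
    intro u hu
    have hlarge : Y.card < (largeNeighbors G L u).card := by
      by_cases h : G.degree u < L
      · rw [hG.largeNeighbors_of_degree_lt h, SimpleGraph.card_neighborFinset_eq_degree]
        exact hY.trans_le (G.minDegree_le_degree u)
      · have := hG.card_largeNeighbors_of_le_degree h
        omega
    obtain ⟨y, hy, hyY⟩ := Finset.exists_mem_notMem_of_card_lt_card hlarge
    rw [mem_largeNeighbors] at hy
    obtain ⟨C, h1, h2, -, h4, h5⟩ := hG.exists_grown hL hm (fun _ : Unit => y)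
      (Function.injective_of_subsingleton _) Y (fun _ => hyY) (fun _ => hy.2)
      (by simp; omega) hm1 le_rfl
    exact ⟨C (), h2 _, h4 _, h5 _, y, h1 (), hy.1⟩
  obtain ⟨u, hu⟩ : ∃ u, u ∉ Y := by
    by_contra! h
    have := Finset.eq_univ_iff_forall.2 h
    rw [this, Finset.card_univ] at hY
    omega
  have huY : u ∈ ((↑Y : Set V)ᶜ) := by simpa using hu
  rw [SimpleGraph.connected_iff_exists_forall_reachable]
  refine ⟨⟨u, huY⟩, ?_⟩
  rintro ⟨v, hvY⟩
  have hv : v ∉ Y := by simpa using hvY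
  obtain ⟨C, hCm, hCY, hC, y, hy, huy⟩ := key u hu
  obtain ⟨C', hCm', hCY', hC', y', hy', hvy'⟩ := key v hv
  have hconn := insert_connected (insert_connected (hG.union_connected hCm hCm' hC hC')
    (Or.inr hy') hvy') (Or.inr (Or.inl hy)) huy
  have hsub : insert u (insert v ((↑C : Set V) ∪ ↑C')) ⊆ ((↑Y : Set V)ᶜ) := by
    rintro z (rfl | rfl | hz | hz)
    · exact huY
    · exact hvY
    · exact fun h => Finset.disjoint_left.1 hCY hz h
    · exact fun h => Finset.disjoint_left.1 hCY' hz h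
  have := hconn.preconnected ⟨u, by simp⟩ ⟨v, by simp⟩
  exact this.map (SimpleGraph.induceHomOfLE G hsub).toHom

lemma IsExpanding.exists_hubs (hG : IsExpanding G L K b m) (hL : 8 * (K + 1) ≤ L)
    (hm : (K + 1) * m ≤ Fintype.card V) (hm1 : 1 ≤ m) {r : ℕ} (hK : 6 * r + 3 ≤ K)
    (s : Fin 3 → V) (hs : Function.Injective s)
    (hr : ∀ i, G.degree (s i) < L → r ≤ (G.neighborFinset (s i) \ Finset.univ.image s).card) :
    ∃ C : Fin r → Set V, (∀ i, (G.induce (C i)).Connected) ∧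
      (∀ i, ∀ x ∈ Set.range s, ∃ c ∈ C i, G.Adj x c) ∧ (∀ i, Disjoint (C i) (Set.range s)) ∧
      ∀ i j, i ≠ j → Disjoint (C i) (C j) := by
  set X := Finset.univ.image s with hX
  have hXcard : X.card ≤ 3 := Finset.card_image_le.trans (by simp)
  let P : Fin 3 → Finset V := fun i => largeNeighbors G L (s i) \ X
  have hPlarge : ∀ i, ¬ G.degree (s i) < L → 3 * r ≤ (P i).card := by
    intro i hi
    have h1 := hG.card_largeNeighbors_of_le_degree hi
    have h2 := Finset.le_card_sdiff X (largeNeighbors G L (s i))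
    simp only [P]
    omega
  have hPr : ∀ i, r ≤ (P i).card := by
    intro i
    by_cases hi : G.degree (s i) < L
    · simp only [P]
      rw [hG.largeNeighbors_of_degree_lt hi]
      exact hr i hi
    · have := hPlarge i hi
      omega
  have hPdis : ∀ i j, i ≠ j → (P i).card < 3 * r → (P j).card < 3 * r →
      Disjoint (P i) (P j) := by
    intro i j hij hi hj
    have hi' : G.degree (s i) < L := by
      by_contra h
      have := hPlarge i h
      omega
    have hj' : G.degree (s j) < L := by
      by_contra h
      have := hPlarge j h
      omega
    rw [Finset.disjoint_left]
    intro z hz hz'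
    simp only [P, Finset.mem_sdiff, mem_largeNeighbors] at hz hz'
    exact hG.not_common _ _ z (hs.ne hij) hi' hj' hz.1.1 hz'.1.1
  obtain ⟨x, hxinj, hx⟩ := exists_injective_representatives P hPr hPdis
  simp only [P, Finset.mem_sdiff, mem_largeNeighbors] at hx
  obtain ⟨C, h1, h2, h3, h4, h5⟩ := hG.exists_grown hL hm x hxinj X (fun q => (hx q).2)
    (fun q => (hx q).1.2) (by simp; omega) hm1 le_rfl
  have hCm : ∀ j, (G.induce ((↑(C (0, j)) ∪ ↑(C (1, j))) ∪ ↑(C (2, j)) : Set V)).Connected := by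
    intro j
    have h01 := hG.union_connected (h2 (0, j)) (h2 (1, j)) (h5 _) (h5 _)
    have h02 := hG.union_connected (h2 (0, j)) (h2 (2, j)) (h5 _) (h5 _)
    have := SimpleGraph.induce_union_connected h01.preconnected h02.preconnected
      ⟨x (0, j), Or.inl (h1 _), Or.inl (h1 _)⟩
    refine induce_connected_of_eq this ?_
    ext z
    simp only [Set.mem_union]
    tauto
  have hmem : ∀ j z, z ∈ ((↑(C (0, j)) ∪ ↑(C (1, j))) ∪ ↑(C (2, j)) : Set V) ↔
      ∃ i, z ∈ C (i, j) := by
    intro j z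
    simp [Fin.exists_fin_succ, or_assoc]
  refine ⟨_, hCm, ?_, ?_, ?_⟩
  · rintro j _ ⟨i, rfl⟩
    exact ⟨x (i, j), (hmem _ _).2 ⟨i, h1 _⟩, (hx (i, j)).1.1⟩
  · intro j
    rw [Set.disjoint_left]
    rintro z hz ⟨i', rfl⟩
    obtain ⟨i, hi⟩ := (hmem _ _).1 hz
    exact Finset.disjoint_left.1 (h4 (i, j)) hi (by simp [hX])
  · intro j j' hjj
    rw [Set.disjoint_left]
    intro z hz hz'
    obtain ⟨i, hi⟩ := (hmem _ _).1 hz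
    obtain ⟨i', hi'⟩ := (hmem _ _).1 hz'
    exact Finset.disjoint_left.1 (h3 (i, j) (i', j') (by simp [hjj])) hi hi'

lemma IsExpanding.minDeg_sub_one_le_kappaSet (hG : IsExpanding G L K b m)
    (hL : 8 * (K + 1) ≤ L) (hm : (K + 1) * m ≤ Fintype.card V) (hm1 : 1 ≤ m)
    (hK : 6 * minDeg G + 3 ≤ K) (s : Fin 3 → V) (hs : Function.Injective s) :
    minDeg G - 1 ≤ kappaSet G (Set.range s) := by
  have h01 : s 0 ≠ s 1 := hs.ne (by decide)
  have hdeg : ∀ v, minDeg G ≤ G.degree v := fun v => G.minDegree_le_degree v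
  have hcardX : (Finset.univ.image s).card = 3 := by
    rw [Finset.card_image_of_injective _ hs]; simp
  have hNX : ∀ i, G.neighborFinset (s i) ∩ Finset.univ.image s ⊆
      (Finset.univ.image s).erase (s i) := by
    intro i z hz
    simp only [Finset.mem_inter, SimpleGraph.mem_neighborFinset] at hz
    exact Finset.mem_erase.2 ⟨hz.1.ne', hz.2⟩
  have hcardE : ∀ i, ((Finset.univ.image s).erase (s i)).card = 2 := by
    intro i
    rw [Finset.card_erase_of_mem (by simp), hcardX]
  have hsplit : ∀ i, (G.neighborFinset (s i) \ Finset.univ.image s).card +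
      (G.neighborFinset (s i) ∩ Finset.univ.image s).card = G.degree (s i) := by
    intro i
    rw [Finset.card_sdiff_add_card_inter, SimpleGraph.card_neighborFinset_eq_degree]
  by_cases hstar : ∃ i, ∀ j, j ≠ i → G.Adj (s i) (s j)
  · obtain ⟨i, hi⟩ := hstar
    obtain ⟨C, h1, h2, h3, h4⟩ := hG.exists_hubs hL hm hm1 (r := minDeg G - 2) (by omega) s hs (by
      intro j _
      have := Finset.card_le_card (hNX j)
      rw [hcardE] at this
      have := hsplit j
      have := hdeg (s j)
      omega)
    have hconn : (G.induce (Set.range s)).Connected := by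
      rw [SimpleGraph.connected_iff_exists_forall_reachable]
      refine ⟨⟨s i, i, rfl⟩, ?_⟩
      rintro ⟨_, j, rfl⟩
      by_cases hj : j = i
      · subst hj; exact SimpleGraph.Reachable.refl _
      · exact SimpleGraph.Adj.reachable (hi j hj)
    have := succ_le_kappaSet_of_hubs (Set.mem_range_self 0) (Set.mem_range_self 1) h01 C h1 h2 h3
      h4 hconn
    omega
  · push Not at hstar
    obtain ⟨C, h1, h2, h3, h4⟩ := hG.exists_hubs hL hm hm1 (r := minDeg G - 1) (by omega) s hs (by
      intro i _
      obtain ⟨j, hji, hj⟩ := hstar i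
      have hss : G.neighborFinset (s i) ∩ Finset.univ.image s ⊂
          (Finset.univ.image s).erase (s i) := by
        refine Finset.ssubset_iff_subset_ne.2 ⟨hNX i, fun h => ?_⟩
        have hmem : s j ∈ (Finset.univ.image s).erase (s i) :=
          Finset.mem_erase.2 ⟨hs.ne hji, by simp⟩
        rw [← h] at hmem
        exact hj (by simpa using hmem)
      have := Finset.card_lt_card hss
      rw [hcardE] at this
      have := hsplit i
      have := hdeg (s i)
      omega)
    exact card_le_kappaSet_of_hubs (Set.mem_range_self 0) (Set.mem_range_self 1) h01 C h1 h2 h3 h4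

/-- The chain of inequalities between the connectivity parameters holds in expanding graphs of
small minimum degree. -/
lemma IsExpanding.sandwich (hG : IsExpanding G L K b m) (hL : 8 * (K + 1) ≤ L)
    (hm : (K + 1) * m ≤ Fintype.card V) (hm1 : 1 ≤ m) (hK : 6 * minDeg G + 3 ≤ K) :
    minDeg G - 1 = edgeConnectivity G - 1 ∧
      edgeConnectivity G - 1 = vertexConnectivity G - 1 ∧
      vertexConnectivity G - 1 ≤ genKappa 3 G ∧ genKappa 3 G ≤ genLambda 3 G ∧
      genLambda 3 G ≤ vertexConnectivity G ∧ vertexConnectivity G = edgeConnectivity G ∧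
      edgeConnectivity G = minDeg G := by
  have hKV : K + 1 ≤ Fintype.card V := (Nat.le_mul_of_pos_right _ hm1).trans hm
  have : Nontrivial V := Fintype.one_lt_card_iff_nontrivial.1 (by omega)
  have h1 : minDeg G ≤ vertexConnectivity G := le_vertexConnectivity (by omega)
    fun Y hY => hG.connected_deleteVerts hL hm hm1 (by omega) (by omega) Y hY
  have h2 := vertexConnectivity_le_edgeConnectivity (G := G)
  have h3 := edgeConnectivity_le_minDeg (G := G)
  have h4 := genKappa_le_genLambda (G := G) (r := 3) (by omega) (by omega)
  have h5 := genLambda_le_minDeg (G := G) (r := 3) (by omega) (by omega)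
  have h6 : minDeg G - 1 ≤ genKappa 3 G := by
    unfold genKappa
    split_ifs with hc
    · obtain ⟨S₀, -, hS₀⟩ := Finset.exists_subset_card_eq (s := (Finset.univ : Finset V)) (n := 3)
        (by rw [Finset.card_univ]; omega)
      refine le_csInf ⟨_, S₀, hS₀, rfl⟩ ?_
      rintro _ ⟨S, hS, rfl⟩
      let e := (S.equivFinOfCardEq hS).symm
      have hrange : (↑S : Set V) = Set.range (fun i => (e i : V)) := by
        ext z
        simp only [Finset.mem_coe, Set.mem_range]
        exact ⟨fun hz => ⟨e.symm ⟨z, hz⟩, by simp⟩, by rintro ⟨i, rfl⟩; exact (e i).2⟩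
      rw [hrange]
      exact hG.minDeg_sub_one_le_kappaSet hL hm hm1 hK _
        (Subtype.val_injective.comp e.injective)
    · have hz : minDeg G = 0 := by
        by_contra hne
        refine hc ?_
        have := hG.connected_deleteVerts hL hm hm1 (by omega) (by omega) ∅ (by simp; omega)
        have e : ((↑(∅ : Finset V) : Set V)ᶜ) = Set.univ := by simp
        rw [e] at this
        exact (SimpleGraph.Iso.connected_iff (SimpleGraph.induceUnivIso _)).1 this
      omega
  refine ⟨by omega, by omega, by omega, h4, by omega, by omega, by omega⟩

end Expanding

/-! ### Cylinder events in the binomial random graph -/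

/-- The graphs containing all edges in `E₁` and none in `E₀`. -/
def cylinder {V : Type*} (E₁ E₀ : Finset (Sym2 V)) : Set (SimpleGraph V) :=
  {G | (∀ e ∈ E₁, e ∈ G.edgeSet) ∧ ∀ e ∈ E₀, e ∉ G.edgeSet}

lemma mem_cylinder {V : Type*} {E₁ E₀ : Finset (Sym2 V)} {G : SimpleGraph V} :
    G ∈ cylinder E₁ E₀ ↔ (∀ e ∈ E₁, e ∈ G.edgeSet) ∧ ∀ e ∈ E₀, e ∉ G.edgeSet := Iff.rfl

section Probability

variable {V : Type*} [Fintype V]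

/-- The probability of `A` in the binomial random graph on the vertex type `V`. -/
noncomputable def graphProb (p : ℝ) (A : Set (SimpleGraph V)) : ℝ :=
  ∑ G ∈ Finset.univ.filter (fun G => G ∈ A),
    p ^ edgeCount G * (1 - p) ^ ((Fintype.card V).choose 2 - edgeCount G)

lemma gnpProb_eq_graphProb (n : ℕ) (p : ℝ) (A : Set (SimpleGraph (Fin n))) :
    gnpProb n p A = graphProb p A := by
  unfold gnpProb graphProb
  simp only [Fintype.card_fin]
  refine Finset.sum_congr ?_ fun _ _ => rfl
  ext; simp

variable {p : ℝ}

lemma graphWeight_nonneg (hp : 0 ≤ p) (hp1 : p ≤ 1) (G : SimpleGraph V) :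
    0 ≤ p ^ edgeCount G * (1 - p) ^ ((Fintype.card V).choose 2 - edgeCount G) :=
  mul_nonneg (pow_nonneg hp _) (pow_nonneg (by linarith) _)

lemma graphProb_nonneg (hp : 0 ≤ p) (hp1 : p ≤ 1) (A : Set (SimpleGraph V)) :
    0 ≤ graphProb p A :=
  Finset.sum_nonneg fun G _ => graphWeight_nonneg hp hp1 G

lemma graphProb_mono (hp : 0 ≤ p) (hp1 : p ≤ 1) {A B : Set (SimpleGraph V)} (h : A ⊆ B) :
    graphProb p A ≤ graphProb p B := by
  refine Finset.sum_le_sum_of_subset_of_nonneg ?_ fun G _ _ => graphWeight_nonneg hp hp1 G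
  intro G hG
  simp only [Finset.mem_filter, Finset.mem_univ, true_and] at hG ⊢
  exact h hG

lemma graphProb_eq_sum_indicator (A : Set (SimpleGraph V)) :
    graphProb p A = ∑ G : SimpleGraph V, (if G ∈ A then (1 : ℝ) else 0) *
      (p ^ edgeCount G * (1 - p) ^ ((Fintype.card V).choose 2 - edgeCount G)) := by
  unfold graphProb
  rw [Finset.sum_filter]
  exact Finset.sum_congr rfl fun G _ => by split_ifs <;> simp

lemma graphProb_le_sum (hp : 0 ≤ p) (hp1 : p ≤ 1) {ι : Type*} (s : Finset ι)
    (A : Set (SimpleGraph V)) (B : ι → Set (SimpleGraph V))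
    (h : ∀ G ∈ A, ∃ i ∈ s, G ∈ B i) : graphProb p A ≤ ∑ i ∈ s, graphProb p (B i) := by
  simp only [graphProb_eq_sum_indicator]
  rw [Finset.sum_comm]
  refine Finset.sum_le_sum fun G _ => ?_
  rw [← Finset.sum_mul]
  refine mul_le_mul_of_nonneg_right ?_ (graphWeight_nonneg hp hp1 G)
  have hnn : ∀ i ∈ s, (0 : ℝ) ≤ if G ∈ B i then 1 else 0 := fun i _ => by split_ifs <;> norm_num
  split_ifs with hG
  · obtain ⟨i, hi, hGi⟩ := h G hG
    refine le_trans ?_ (Finset.single_le_sum hnn hi)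
    rw [if_pos hGi]
  · exact Finset.sum_nonneg hnn

lemma graphProb_cylinder {E₁ E₀ : Finset (Sym2 V)} (hd : Disjoint E₁ E₀)
    (h₁ : E₁ ⊆ (⊤ : SimpleGraph V).edgeFinset) (h₀ : E₀ ⊆ (⊤ : SimpleGraph V).edgeFinset) :
    graphProb p (cylinder E₁ E₀) = p ^ E₁.card * (1 - p) ^ E₀.card := by
  set Ω := (⊤ : SimpleGraph V).edgeFinset with hΩ
  have hΩc : Ω.card = (Fintype.card V).choose 2 := by
    rw [hΩ, SimpleGraph.card_edgeFinset_top_eq_card_choose_two]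
  set R := Ω \ (E₁ ∪ E₀) with hR
  have hRc : R.card + (E₁.card + E₀.card) = (Fintype.card V).choose 2 := by
    rw [← Finset.card_union_of_disjoint hd, ← hΩc]
    exact Finset.card_sdiff_add_card_eq_card (Finset.union_subset h₁ h₀)
  have hnd : ∀ {e}, e ∈ Ω ↔ ¬ e.IsDiag := by
    intro e; simp [hΩ]
  have hRE : ∀ F ⊆ R, Disjoint E₁ F := by
    intro F hF
    rw [Finset.disjoint_left]
    intro e he he'
    have := hF he'
    simp [hR] at this
    exact this.2.1 he
  have hedge : ∀ F ⊆ R, (SimpleGraph.fromEdgeSet (↑(E₁ ∪ F) : Set (Sym2 V))).edgeFinset =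
      E₁ ∪ F := by
    intro F hF
    ext e
    simp only [SimpleGraph.mem_edgeFinset, SimpleGraph.edgeSet_fromEdgeSet]
    constructor
    · intro h; exact_mod_cast h.1
    · intro h
      refine ⟨by exact_mod_cast h, ?_⟩
      have : e ∈ Ω := by
        rcases Finset.mem_union.1 h with h | h
        · exact h₁ h
        · exact (Finset.mem_sdiff.1 (hF h)).1
      exact hnd.1 this
  have hstep : graphProb p (cylinder E₁ E₀) = ∑ F ∈ R.powerset,
      p ^ E₁.card * (1 - p) ^ E₀.card * (p ^ F.card * (1 - p) ^ (R.card - F.card)) := by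
    unfold graphProb
    refine Finset.sum_bij' (fun G _ => G.edgeFinset \ E₁)
      (fun F _ => SimpleGraph.fromEdgeSet (↑(E₁ ∪ F) : Set (Sym2 V))) ?_ ?_ ?_ ?_ ?_
    · intro G hG
      simp only [Finset.mem_filter, Finset.mem_univ, true_and, mem_cylinder] at hG
      rw [Finset.mem_powerset]
      intro e he
      rw [Finset.mem_sdiff, SimpleGraph.mem_edgeFinset] at he
      simp only [hR, Finset.mem_sdiff, Finset.mem_union, not_or]
      exact ⟨hnd.2 (G.not_isDiag_of_mem_edgeSet he.1), he.2, fun h => hG.2 e h he.1⟩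
    · intro F hF
      rw [Finset.mem_powerset] at hF
      have hmem : ∀ e, e ∈ (SimpleGraph.fromEdgeSet (↑(E₁ ∪ F) : Set (Sym2 V))).edgeSet ↔
          e ∈ E₁ ∪ F := fun e => by
        rw [← SimpleGraph.mem_edgeFinset (G := SimpleGraph.fromEdgeSet _), hedge F hF]
      refine Finset.mem_filter.2 ⟨Finset.mem_univ _,
        mem_cylinder.2 ⟨fun e he => ?_, fun e he h => ?_⟩⟩
      · exact (hmem e).2 (Finset.mem_union_left _ he)
      · rcases Finset.mem_union.1 ((hmem e).1 h) with h | h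
        · exact Finset.disjoint_left.1 hd h he
        · have := hF h
          simp only [hR, Finset.mem_sdiff, Finset.mem_union, not_or] at this
          exact this.2.2 he
    · intro G hG
      simp only [Finset.mem_filter, Finset.mem_univ, true_and, mem_cylinder] at hG
      rw [Finset.union_sdiff_of_subset]
      · simp
      · intro e he
        exact SimpleGraph.mem_edgeFinset.2 (hG.1 e he)
    · intro F hF
      rw [Finset.mem_powerset] at hF
      refine Eq.trans ?_ (Finset.union_sdiff_cancel_left (hRE F hF))
      congr 1
      convert hedge F hF
    · intro G hG
      simp only [Finset.mem_filter, Finset.mem_univ, true_and, mem_cylinder] at hG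
      have hsub : E₁ ⊆ G.edgeFinset := fun e he => SimpleGraph.mem_edgeFinset.2 (hG.1 e he)
      have hFR : G.edgeFinset \ E₁ ⊆ R := by
        intro e he
        rw [Finset.mem_sdiff, SimpleGraph.mem_edgeFinset] at he
        simp only [hR, Finset.mem_sdiff, Finset.mem_union, not_or]
        exact ⟨hnd.2 (G.not_isDiag_of_mem_edgeSet he.1), he.2, fun h => hG.2 e h he.1⟩
      have hc1 := Finset.card_sdiff_add_card_eq_card hsub
      have hc2 := Finset.card_le_card hFR
      have e1 : edgeCount G = E₁.card + (G.edgeFinset \ E₁).card := by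
        rw [edgeCount]; omega
      have e2 : (Fintype.card V).choose 2 - edgeCount G =
          E₀.card + (R.card - (G.edgeFinset \ E₁).card) := by omega
      rw [e2, e1, pow_add, pow_add]
      ring
  rw [hstep, ← Finset.mul_sum, Finset.sum_pow_mul_eq_add_pow]
  simp

lemma graphProb_univ : graphProb p (Set.univ : Set (SimpleGraph V)) = 1 := by
  have := graphProb_cylinder (p := p) (V := V) (E₁ := ∅) (E₀ := ∅) (by simp) (by simp) (by simp)
  have h : cylinder (∅ : Finset (Sym2 V)) ∅ = Set.univ := by
    ext G
    simp [mem_cylinder]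
  simpa [h] using this

lemma graphProb_compl (A : Set (SimpleGraph V)) : graphProb p Aᶜ = 1 - graphProb p A := by
  rw [← graphProb_univ (V := V) (p := p)]
  simp only [graphProb_eq_sum_indicator]
  rw [← Finset.sum_sub_distrib]
  refine Finset.sum_congr rfl fun G _ => ?_
  by_cases h : G ∈ A <;> simp [h]

/-- Chebyshev's inequality for the number of events in a finite family that occur. -/
lemma graphProb_forall_notMem_mul_sq_le (hp : 0 ≤ p) (hp1 : p ≤ 1) {ι : Type*} (s : Finset ι)
    (B : ι → Set (SimpleGraph V)) :
    graphProb p {G | ∀ i ∈ s, G ∉ B i} * (∑ i ∈ s, graphProb p (B i)) ^ 2 ≤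
      ∑ i ∈ s, ∑ j ∈ s, graphProb p (B i ∩ B j) - (∑ i ∈ s, graphProb p (B i)) ^ 2 := by
  set μ := ∑ i ∈ s, graphProb p (B i) with hμ
  set w : SimpleGraph V → ℝ := fun G =>
    p ^ edgeCount G * (1 - p) ^ ((Fintype.card V).choose 2 - edgeCount G) with hw
  set X : SimpleGraph V → ℝ := fun G => ∑ i ∈ s, if G ∈ B i then (1 : ℝ) else 0 with hX
  have h1 : ∑ G, X G * w G = μ := by
    simp only [hμ, graphProb_eq_sum_indicator, hX, Finset.sum_mul]
    rw [Finset.sum_comm]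
  have h2 : ∑ G, X G ^ 2 * w G = ∑ i ∈ s, ∑ j ∈ s, graphProb p (B i ∩ B j) := by
    simp only [graphProb_eq_sum_indicator, hX, sq, Finset.sum_mul_sum]
    simp only [Finset.sum_mul]
    rw [Finset.sum_comm]
    refine Finset.sum_congr rfl fun i _ => ?_
    rw [Finset.sum_comm]
    refine Finset.sum_congr rfl fun j _ => Finset.sum_congr rfl fun G _ => ?_
    by_cases hi : G ∈ B i <;> by_cases hj : G ∈ B j <;> simp [hi, hj, hw]
  have h3 : ∑ G, w G = 1 := by
    have := graphProb_univ (V := V) (p := p)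
    simpa [graphProb_eq_sum_indicator] using this
  have h4 : ∑ G, (X G - μ) ^ 2 * w G =
      ∑ i ∈ s, ∑ j ∈ s, graphProb p (B i ∩ B j) - μ ^ 2 := by
    have : ∀ G, (X G - μ) ^ 2 * w G = X G ^ 2 * w G - 2 * μ * (X G * w G) + μ ^ 2 * w G := by
      intro G; ring
    simp only [this, Finset.sum_add_distrib, Finset.sum_sub_distrib, ← Finset.mul_sum, h1, h2, h3]
    ring
  rw [← h4, graphProb_eq_sum_indicator, Finset.sum_mul]
  refine Finset.sum_le_sum fun G _ => ?_
  have hwG : 0 ≤ w G := graphWeight_nonneg hp hp1 G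
  by_cases hG : G ∈ {G | ∀ i ∈ s, G ∉ B i}
  · have hX0 : X G = 0 := Finset.sum_eq_zero fun i hi => if_neg (hG i hi)
    rw [if_pos hG, hX0]
    simp only [hw]
    ring_nf
    exact le_rfl
  · rw [if_neg hG]
    simp only [zero_mul]
    positivity

end Probability

/-! ### Stars -/

section Stars

variable {V : Type*}

/-- The edges joining `u` to the vertices of `S`. -/
noncomputable def starEdges (u : V) (S : Finset V) : Finset (Sym2 V) :=
  S.image fun x => s(u, x)

lemma mem_starEdges {u : V} {S : Finset V} {e : Sym2 V} :
    e ∈ starEdges u S ↔ ∃ x ∈ S, s(u, x) = e := by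
  simp [starEdges]

lemma mk_mem_starEdges {u x : V} {S : Finset V} : s(u, x) ∈ starEdges u S ↔ x ∈ S := by
  rw [mem_starEdges]
  constructor
  · rintro ⟨y, hy, h⟩
    rwa [← Sym2.congr_right.1 h]
  · exact fun h => ⟨x, h, rfl⟩

lemma card_starEdges (u : V) (S : Finset V) : (starEdges u S).card = S.card :=
  Finset.card_image_of_injective _ fun _ _ h => Sym2.congr_right.1 h

lemma disjoint_starEdges {u : V} {S T : Finset V} (h : Disjoint S T) :
    Disjoint (starEdges u S) (starEdges u T) := by
  rw [Finset.disjoint_left]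
  intro e he he'
  obtain ⟨x, hx, rfl⟩ := mem_starEdges.1 he
  exact Finset.disjoint_left.1 h hx (mk_mem_starEdges.1 he')

variable {R S T : Finset V} {u v : V}

lemma disjoint_starEdges_of_subset_sym2 {E : Finset (Sym2 V)} (hE : E ⊆ R.sym2)
    (hS : Disjoint R S) : Disjoint E (starEdges u S) := by
  rw [Finset.disjoint_left]
  intro e he he'
  obtain ⟨x, hx, rfl⟩ := mem_starEdges.1 he'
  exact Finset.disjoint_left.1 hS (Finset.mk_mem_sym2_iff.1 (hE he)).2 hx

lemma disjoint_starEdges_of_ne (huv : u ≠ v) (hv : v ∈ R) (hS : Disjoint R S) :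
    Disjoint (starEdges u S) (starEdges v T) := by
  rw [Finset.disjoint_left]
  intro e he he'
  obtain ⟨x, hx, rfl⟩ := mem_starEdges.1 he
  obtain ⟨y, hy, h⟩ := mem_starEdges.1 he'
  rcases Sym2.eq_iff.1 h with h | h
  · exact huv h.1.symm
  · exact Finset.disjoint_left.1 hS hv (h.1 ▸ hx)

lemma starEdges_subset_edgeFinset_top [Fintype V] (hu : u ∈ R) (hS : Disjoint R S) :
    starEdges u S ⊆ (⊤ : SimpleGraph V).edgeFinset := by
  intro e he
  obtain ⟨x, hx, rfl⟩ := mem_starEdges.1 he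
  rw [SimpleGraph.mem_edgeFinset, SimpleGraph.mem_edgeSet, SimpleGraph.top_adj]
  rintro rfl
  exact Finset.disjoint_left.1 hS hu hx

variable [Fintype V] {p : ℝ}

/-- The edges in `E₁` are present, those in `E₀` are absent, and the neighbourhoods of `u` and `v`
outside `R` are `S` and `T`. -/
noncomputable def twoStar (R : Finset V) (E₁ E₀ : Finset (Sym2 V)) (u v : V) (S T : Finset V) :
    Set (SimpleGraph V) :=
  cylinder (E₁ ∪ (starEdges u S ∪ starEdges v T))
    (E₀ ∪ (starEdges u (Rᶜ \ S) ∪ starEdges v (Rᶜ \ T)))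

lemma graphProb_twoStar {E₁ E₀ : Finset (Sym2 V)} (huv : u ≠ v) (hu : u ∈ R) (hv : v ∈ R)
    (h₁ : E₁ ⊆ R.sym2) (h₀ : E₀ ⊆ R.sym2) (h₁' : E₁ ⊆ (⊤ : SimpleGraph V).edgeFinset)
    (h₀' : E₀ ⊆ (⊤ : SimpleGraph V).edgeFinset) (hd : Disjoint E₁ E₀)
    (hS : S ⊆ Rᶜ) (hT : T ⊆ Rᶜ) :
    graphProb p (twoStar R E₁ E₀ u v S T) =
      p ^ (E₁.card + (S.card + T.card)) *
        (1 - p) ^ (E₀.card + ((Rᶜ.card - S.card) + (Rᶜ.card - T.card))) := by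
  have hRS : Disjoint R S := (Finset.subset_compl_iff_disjoint_left.1 hS)
  have hRT : Disjoint R T := (Finset.subset_compl_iff_disjoint_left.1 hT)
  have hRS' : Disjoint R (Rᶜ \ S) :=
    Finset.subset_compl_iff_disjoint_left.1 Finset.sdiff_subset
  have hRT' : Disjoint R (Rᶜ \ T) :=
    Finset.subset_compl_iff_disjoint_left.1 Finset.sdiff_subset
  rw [twoStar, graphProb_cylinder]
  · rw [Finset.card_union_of_disjoint, Finset.card_union_of_disjoint,
      Finset.card_union_of_disjoint, Finset.card_union_of_disjoint]
    · simp only [card_starEdges, Finset.card_sdiff_of_subset hS, Finset.card_sdiff_of_subset hT]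
    · exact disjoint_starEdges_of_ne huv hv hRS'
    · exact (disjoint_starEdges_of_subset_sym2 h₀ hRS').sup_right
        (disjoint_starEdges_of_subset_sym2 h₀ hRT')
    · exact disjoint_starEdges_of_ne huv hv hRS
    · exact (disjoint_starEdges_of_subset_sym2 h₁ hRS).sup_right
        (disjoint_starEdges_of_subset_sym2 h₁ hRT)
  · refine Disjoint.sup_left (hd.sup_right (Disjoint.sup_right ?_ ?_))
      (Disjoint.sup_right ?_ (Disjoint.sup_left (Disjoint.sup_right ?_ ?_)
        (Disjoint.sup_right ?_ ?_)))
    · exact disjoint_starEdges_of_subset_sym2 h₁ hRS'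
    · exact disjoint_starEdges_of_subset_sym2 h₁ hRT'
    · exact ((disjoint_starEdges_of_subset_sym2 h₀ hRS).sup_right
        (disjoint_starEdges_of_subset_sym2 h₀ hRT)).symm
    · exact disjoint_starEdges Finset.disjoint_sdiff
    · exact disjoint_starEdges_of_ne huv hv hRS
    · exact disjoint_starEdges_of_ne huv.symm hu hRT
    · exact disjoint_starEdges Finset.disjoint_sdiff
  · exact Finset.union_subset h₁' (Finset.union_subset (starEdges_subset_edgeFinset_top hu hRS)
      (starEdges_subset_edgeFinset_top hv hRT))
  · exact Finset.union_subset h₀' (Finset.union_subset (starEdges_subset_edgeFinset_top hu hRS')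
      (starEdges_subset_edgeFinset_top hv hRT'))

lemma mem_twoStar {E₁ : Finset (Sym2 V)} {G : SimpleGraph V} (h : ∀ e ∈ E₁, e ∈ G.edgeSet) :
    G ∈ twoStar R E₁ ∅ u v (G.neighborFinset u \ R) (G.neighborFinset v \ R) := by
  rw [twoStar, mem_cylinder]
  refine ⟨fun e he => ?_, fun e he => ?_⟩
  · rcases Finset.mem_union.1 he with he | he
    · exact h e he
    rcases Finset.mem_union.1 he with he | he
    all_goals
      obtain ⟨x, hx, rfl⟩ := mem_starEdges.1 he
      simp only [Finset.mem_sdiff, SimpleGraph.mem_neighborFinset] at hx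
      exact hx.1
  · rw [Finset.empty_union] at he
    rcases Finset.mem_union.1 he with he | he
    all_goals
      obtain ⟨x, hx, rfl⟩ := mem_starEdges.1 he
      simp only [Finset.mem_sdiff, SimpleGraph.mem_neighborFinset, Finset.mem_compl, not_and,
        not_not] at hx
      exact fun hxG => hx.1 (hx.2 hxG)

lemma sum_powerset_card_lt_le (hp : 0 ≤ p) (hp1 : p ≤ 1) {N L : ℕ} (W : Finset V)
    (hN : N + L ≤ W.card) (hnp : 1 ≤ Fintype.card V * p) :
    ∑ S ∈ W.powerset.filter (fun S => S.card < L), p ^ S.card * (1 - p) ^ (W.card - S.card) ≤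
      L * (Fintype.card V * p) ^ L * (1 - p) ^ N := by
  have hq : 0 ≤ 1 - p := by linarith
  have hmaps : ∀ S ∈ W.powerset.filter (fun S => S.card < L), S.card ∈ Finset.range L := by
    intro S hS
    exact Finset.mem_range.2 (Finset.mem_filter.1 hS).2
  rw [← Finset.sum_fiberwise_of_maps_to hmaps]
  calc _ ≤ ∑ _s ∈ Finset.range L, (Fintype.card V * p) ^ L * (1 - p) ^ N := by
        refine Finset.sum_le_sum fun s hs => ?_
        rw [Finset.mem_range] at hs
        calc _ ≤ ∑ _S ∈ W.powersetCard s, p ^ s * (1 - p) ^ N := by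
              refine (Finset.sum_le_sum (g := fun _ => p ^ s * (1 - p) ^ N) fun S hS => ?_).trans
                (Finset.sum_le_sum_of_subset_of_nonneg ?_ fun _ _ _ => by positivity)
              · have hSs := (Finset.mem_filter.1 hS).2
                simp only [hSs]
                refine mul_le_mul_of_nonneg_left ?_ (by positivity)
                exact pow_le_pow_of_le_one hq (by linarith) (by omega)
              · intro S hS
                simp only [Finset.mem_filter, Finset.mem_powerset] at hS
                exact Finset.mem_powersetCard.2 ⟨hS.1.1, hS.2⟩
          _ = W.card.choose s * p ^ s * (1 - p) ^ N := by
              rw [Finset.sum_const, Finset.card_powersetCard, nsmul_eq_mul]; ring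
          _ ≤ (Fintype.card V * p) ^ L * (1 - p) ^ N := by
              refine mul_le_mul_of_nonneg_right ?_ (by positivity)
              have h1 : (W.card.choose s : ℝ) ≤ (Fintype.card V : ℝ) ^ s := by
                exact_mod_cast (Nat.choose_le_pow _ _).trans
                  (Nat.pow_le_pow_left (Finset.card_le_univ W) s)
              calc _ ≤ (Fintype.card V : ℝ) ^ s * p ^ s := by gcongr
                _ = (Fintype.card V * p) ^ s := (mul_pow _ _ _).symm
                _ ≤ _ := pow_le_pow_right₀ hnp hs.le
    _ = _ := by
        rw [Finset.sum_const, Finset.card_range, nsmul_eq_mul]; ring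

/-- Two vertices are unlikely to have small degree simultaneously, even when some edges
are prescribed. -/
lemma graphProb_two_low_degrees_le (hp : 0 ≤ p) (hp1 : p ≤ 1) {N L : ℕ}
    {E₁ : Finset (Sym2 V)} (huv : u ≠ v) (hu : u ∈ R) (hv : v ∈ R)
    (h₁ : E₁ ⊆ R.sym2) (h₁' : E₁ ⊆ (⊤ : SimpleGraph V).edgeFinset)
    (hN : N + L + R.card ≤ Fintype.card V) (hnp : 1 ≤ Fintype.card V * p) :
    graphProb p {G | (∀ e ∈ E₁, e ∈ G.edgeSet) ∧ G.degree u < L ∧ G.degree v < L} ≤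
      p ^ E₁.card * (L * (Fintype.card V * p) ^ L * (1 - p) ^ N) ^ 2 := by
  set P := Rᶜ.powerset.filter (fun S => S.card < L) with hP
  have hmem : ∀ {G : SimpleGraph V} {w : V}, G.degree w < L → G.neighborFinset w \ R ∈ P := by
    intro G w hw
    refine Finset.mem_filter.2 ⟨Finset.mem_powerset.2 fun x hx => ?_, ?_⟩
    · exact Finset.mem_compl.2 (Finset.mem_sdiff.1 hx).2
    · exact (Finset.card_le_card Finset.sdiff_subset).trans_lt hw
  have hcard : N + L ≤ Rᶜ.card := by
    rw [Finset.card_compl]; omega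
  calc _ ≤ ∑ ST ∈ P ×ˢ P, graphProb p (twoStar R E₁ ∅ u v ST.1 ST.2) := by
        refine graphProb_le_sum hp hp1 _ _ _ fun G hG => ?_
        obtain ⟨hE, h1, h2⟩ := hG
        exact ⟨(_, _), Finset.mem_product.2 ⟨hmem h1, hmem h2⟩, mem_twoStar hE⟩
    _ = p ^ E₁.card * (∑ S ∈ P, p ^ S.card * (1 - p) ^ (Rᶜ.card - S.card)) ^ 2 := by
        rw [sq, Finset.sum_mul_sum, ← Finset.sum_product', Finset.mul_sum]
        refine Finset.sum_congr rfl fun ST hST => ?_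
        obtain ⟨hS, hT⟩ := Finset.mem_product.1 hST
        rw [graphProb_twoStar huv hu hv h₁ (by simp) h₁' (by simp) (by simp)
          (Finset.mem_powerset.1 (Finset.mem_filter.1 hS).1)
          (Finset.mem_powerset.1 (Finset.mem_filter.1 hT).1)]
        rw [Finset.card_empty, zero_add, pow_add, pow_add, pow_add]
        ring
    _ ≤ _ := by
        have hq : 0 ≤ 1 - p := by linarith
        refine mul_le_mul_of_nonneg_left (pow_le_pow_left₀ ?_ ?_ 2) (by positivity)
        · exact Finset.sum_nonneg fun _ _ => by positivity
        · exact sum_powerset_card_lt_le hp hp1 _ hcard hnp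

lemma graphProb_adj_low_degree_le (hp : 0 ≤ p) (hp1 : p ≤ 1) {N L : ℕ}
    (hN : N + L + 3 ≤ Fintype.card V) (hnp : 1 ≤ Fintype.card V * p) :
    graphProb p {G : SimpleGraph V | ∃ u v, G.degree u < L ∧ G.degree v < L ∧ G.Adj u v} ≤
      (Fintype.card V : ℝ) ^ 2 * (p * (L * (Fintype.card V * p) ^ L * (1 - p) ^ N) ^ 2) := by
  have hq : 0 ≤ 1 - p := by linarith
  set B : V × V → Set (SimpleGraph V) := fun x =>
    {G | (∀ e ∈ ({s(x.1, x.2)} : Finset (Sym2 V)), e ∈ G.edgeSet) ∧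
      G.degree x.1 < L ∧ G.degree x.2 < L} with hB
  calc _ ≤ ∑ x : V × V, graphProb p (if x.1 = x.2 then ∅ else B x) := by
        refine graphProb_le_sum hp hp1 _ _ _ fun G hG => ?_
        obtain ⟨u, v, hu, hv, huv⟩ := hG
        refine ⟨(u, v), Finset.mem_univ _, ?_⟩
        rw [if_neg huv.ne]
        exact ⟨by simpa using huv, hu, hv⟩
    _ ≤ ∑ _x : V × V, p * (L * (Fintype.card V * p) ^ L * (1 - p) ^ N) ^ 2 := by
        refine Finset.sum_le_sum fun x _ => ?_
        split_ifs with h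
        · simp only [graphProb, Set.mem_empty_iff_false, Finset.filter_false, Finset.sum_empty]
          positivity
        · have := graphProb_two_low_degrees_le (R := {x.1, x.2}) (E₁ := {s(x.1, x.2)}) hp hp1 h
            (by simp) (by simp) (by simp) (by simpa using h)
            (N := N) (L := L) (by rw [Finset.card_pair h]; omega) hnp
          rwa [Finset.card_singleton, pow_one] at this
    _ = _ := by
        rw [Finset.sum_const, Finset.card_univ, Fintype.card_prod, nsmul_eq_mul]
        push_cast; ring

lemma graphProb_common_neighbor_low_degree_le (hp : 0 ≤ p) (hp1 : p ≤ 1) {N L : ℕ}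
    (hN : N + L + 3 ≤ Fintype.card V) (hnp : 1 ≤ Fintype.card V * p) :
    graphProb p {G : SimpleGraph V | ∃ u v z, u ≠ v ∧ G.degree u < L ∧ G.degree v < L ∧
        G.Adj u z ∧ G.Adj v z} ≤
      (Fintype.card V : ℝ) ^ 3 *
        (p ^ 2 * (L * (Fintype.card V * p) ^ L * (1 - p) ^ N) ^ 2) := by
  have hq : 0 ≤ 1 - p := by linarith
  set B : V × V × V → Set (SimpleGraph V) := fun x =>
    {G | (∀ e ∈ ({s(x.1, x.2.2), s(x.2.1, x.2.2)} : Finset (Sym2 V)), e ∈ G.edgeSet) ∧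
      G.degree x.1 < L ∧ G.degree x.2.1 < L} with hB
  calc _ ≤ ∑ x : V × V × V, graphProb p
        (if x.1 = x.2.1 ∨ x.1 = x.2.2 ∨ x.2.1 = x.2.2 then ∅ else B x) := by
        refine graphProb_le_sum hp hp1 _ _ _ fun G hG => ?_
        obtain ⟨u, v, z, huv, hu, hv, huz, hvz⟩ := hG
        refine ⟨(u, v, z), Finset.mem_univ _, ?_⟩
        rw [if_neg (by simp [huv, huz.ne, hvz.ne])]
        refine ⟨fun e he => ?_, hu, hv⟩
        rcases Finset.mem_insert.1 he with rfl | he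
        · exact huz
        · rw [Finset.mem_singleton.1 he]; exact hvz
    _ ≤ ∑ _x : V × V × V, p ^ 2 * (L * (Fintype.card V * p) ^ L * (1 - p) ^ N) ^ 2 := by
        refine Finset.sum_le_sum fun x _ => ?_
        split_ifs with h
        · simp only [graphProb, Set.mem_empty_iff_false, Finset.filter_false, Finset.sum_empty]
          positivity
        · push Not at h
          obtain ⟨h1, h2, h3⟩ := h
          have hne : s(x.1, x.2.2) ≠ s(x.2.1, x.2.2) := fun h => h1 (Sym2.congr_left.1 h)
          have := graphProb_two_low_degrees_le (R := {x.1, x.2.1, x.2.2})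
            (E₁ := {s(x.1, x.2.2), s(x.2.1, x.2.2)}) hp hp1 h1
            (by simp) (by simp) (by intro e he; simp at he; rcases he with rfl | rfl <;> simp)
            (by
              intro e he
              simp only [Finset.mem_insert, Finset.mem_singleton] at he
              rcases he with rfl | rfl <;> simpa)
            (N := N) (L := L)
            (by have := Finset.card_le_three (a := x.1) (b := x.2.1) (c := x.2.2); omega) hnp
          rwa [Finset.card_pair hne] at this
    _ = _ := by
        rw [Finset.sum_const, Finset.card_univ, Fintype.card_prod, Fintype.card_prod,
          nsmul_eq_mul]
        push_cast; ring

end Stars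

/-! ### Union bounds for expansion -/

section UnionBounds

/-- The edges joining `A` to `C`. -/
noncomputable def betweenEdges {V : Type*} (A C : Finset V) : Finset (Sym2 V) :=
  (A ×ˢ C).image fun x => s(x.1, x.2)

lemma card_betweenEdges {V : Type*} {A C : Finset V} (h : Disjoint A C) :
    (betweenEdges A C).card = A.card * C.card := by
  rw [betweenEdges, Finset.card_image_of_injOn, Finset.card_product]
  rintro ⟨a, c⟩ hx ⟨a', c'⟩ hy hxy
  simp only [Finset.coe_product, Set.mem_prod, Finset.mem_coe] at hx hy
  rcases Sym2.eq_iff.1 hxy with h' | h'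
  · exact Prod.ext h'.1 h'.2
  · have h1 : a = c' := h'.1
    exact absurd hy.2 (h1 ▸ Finset.disjoint_left.1 h hx.1)

variable {V : Type*} [Fintype V] {p : ℝ}

lemma choose_mul_pow_self_le (N t : ℕ) : (N.choose t : ℝ) * (t : ℝ) ^ t ≤ (Real.exp 1 * N) ^ t := by
  have h1 : (N.choose t : ℝ) ≤ (N : ℝ) ^ t / t.factorial := Nat.choose_le_pow_div t N
  have h2 : (t : ℝ) ^ t / t.factorial ≤ Real.exp t :=
    Real.pow_div_factorial_le_exp _ (Nat.cast_nonneg t) t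
  calc (N.choose t : ℝ) * (t : ℝ) ^ t ≤ (N : ℝ) ^ t / t.factorial * (t : ℝ) ^ t := by gcongr
    _ = (t : ℝ) ^ t / t.factorial * (N : ℝ) ^ t := by ring
    _ ≤ Real.exp t * (N : ℝ) ^ t := by gcongr
    _ = _ := by rw [mul_pow, ← Real.exp_nat_mul, mul_one]

lemma choose_le_exp_mul_div_pow (N : ℕ) {t : ℕ} (ht : 1 ≤ t) :
    (N.choose t : ℝ) ≤ (Real.exp 1 * N / t) ^ t := by
  have ht0 : (0 : ℝ) < t := by exact_mod_cast ht
  rw [div_pow, le_div_iff₀ (pow_pos ht0 t)]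
  exact choose_mul_pow_self_le N t

lemma sum_pow_Icc_le {x : ℝ} (hx : 0 ≤ x) (hx1 : x ≤ 1 / 2) (s : Finset ℕ)
    (hs : ∀ t ∈ s, 1 ≤ t) : ∑ t ∈ s, x ^ t ≤ 2 * x := by
  have hx1' : x < 1 := by linarith
  have hsum : Summable fun t : ℕ => x ^ t := summable_geometric_of_lt_one hx hx1'
  have h0 : 0 ∉ s := fun h => absurd (hs 0 h) (by norm_num)
  have h1 : ∑ t ∈ insert 0 s, x ^ t ≤ ∑' t, x ^ t :=
    hsum.sum_le_tsum _ fun t _ => pow_nonneg hx t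
  rw [Finset.sum_insert h0, pow_zero, tsum_geometric_of_lt_one hx hx1'] at h1
  have h2 : (1 - x)⁻¹ ≤ 1 + 2 * x := by
    rw [inv_le_iff_one_le_mul₀ (by linarith)]
    nlinarith
  linarith

lemma one_sub_pow_le_exp (hp1 : p ≤ 1) (N : ℕ) : (1 - p) ^ N ≤ Real.exp (-(p * N)) := by
  calc (1 - p) ^ N ≤ Real.exp (-p) ^ N :=
        pow_le_pow_left₀ (by linarith) (Real.one_sub_le_exp_neg p) N
    _ = _ := by rw [← Real.exp_nat_mul]; congr 1; ring

/-- Small vertex sets are unlikely to span twice as many edges as vertices. -/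
lemma graphProb_dense_le (hp : 0 ≤ p) (hp1 : p ≤ 1) {b : ℕ}
    (hx : 6 * Fintype.card V * b * p ^ 2 ≤ 1 / 2) :
    graphProb p {G : SimpleGraph V | ∃ B : Finset V, B.Nonempty ∧ B.card ≤ b ∧
        ∃ F : Finset (Sym2 V), F ⊆ B.sym2 ∧ F ⊆ G.edgeFinset ∧ F.card = 2 * B.card} ≤
      2 * (6 * Fintype.card V * b * p ^ 2) := by
  set n := Fintype.card V with hn
  set Ω := (⊤ : SimpleGraph V).edgeFinset with hΩ
  set s := (Finset.univ : Finset (Finset V)).filter (fun B => B.Nonempty ∧ B.card ≤ b) with hs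
  have hB : ∀ t ∈ Finset.Icc 1 b, ∀ B ∈ Finset.univ.powersetCard t,
      ∑ F ∈ (B.sym2 ∩ Ω).powersetCard (2 * t), graphProb p (cylinder F ∅) ≤
      ((t ^ 2).choose (2 * t) : ℝ) * p ^ (2 * t) := by
    intro t ht B hB
    have hBt := (Finset.mem_powersetCard.1 hB).2
    have ht1 := (Finset.mem_Icc.1 ht).1
    have hc : (B.sym2 ∩ Ω).card ≤ t ^ 2 := by
      refine (Finset.card_le_card Finset.inter_subset_left).trans ?_
      rw [Finset.card_sym2, hBt, Nat.choose_two_right]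
      apply Nat.div_le_of_le_mul
      simp only [Nat.add_sub_cancel]
      nlinarith
    calc _ = ∑ F ∈ (B.sym2 ∩ Ω).powersetCard (2 * t), p ^ (2 * t) := by
          refine Finset.sum_congr rfl fun F hF => ?_
          obtain ⟨hF1, hF2⟩ := Finset.mem_powersetCard.1 hF
          rw [graphProb_cylinder (by simp) (hF1.trans Finset.inter_subset_right) (by simp), hF2]
          simp
      _ = ((B.sym2 ∩ Ω).card.choose (2 * t) : ℝ) * p ^ (2 * t) := by
          rw [Finset.sum_const, Finset.card_powersetCard, nsmul_eq_mul]
      _ ≤ _ := by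
          refine mul_le_mul_of_nonneg_right ?_ (by positivity)
          exact_mod_cast Nat.choose_le_choose _ hc
  have hterm : ∀ t ∈ Finset.Icc 1 b,
      (n.choose t : ℝ) * (((t ^ 2).choose (2 * t) : ℝ) * p ^ (2 * t)) ≤
        (6 * n * b * p ^ 2) ^ t := by
    intro t ht
    obtain ⟨ht1, htb⟩ := Finset.mem_Icc.1 ht
    have ht0 : (0 : ℝ) < t := by exact_mod_cast ht1
    have htb' : (t : ℝ) ≤ b := by exact_mod_cast htb
    have h1 := choose_le_exp_mul_div_pow n ht1
    have h2 := choose_le_exp_mul_div_pow (t ^ 2) (t := 2 * t) (by omega)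
    have he : Real.exp 1 ^ 3 ≤ 24 := by
      have := Real.exp_one_lt_d9
      have h0 := Real.exp_pos 1
      calc Real.exp 1 ^ 3 ≤ 2.7182818286 ^ 3 := by gcongr
        _ ≤ 24 := by norm_num
    calc _ ≤ (Real.exp 1 * n / t) ^ t *
          ((Real.exp 1 * ((t ^ 2 : ℕ) : ℝ) / ((2 * t : ℕ) : ℝ)) ^ (2 * t) * p ^ (2 * t)) := by
          gcongr
      _ = (Real.exp 1 ^ 3 / 4 * n * t * p ^ 2) ^ t := by
          rw [pow_mul _ 2 t, pow_mul _ 2 t, ← mul_pow, ← mul_pow]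
          congr 1
          push_cast
          field_simp
          ring
      _ ≤ (6 * n * b * p ^ 2) ^ t := by
          have : Real.exp 1 ^ 3 / 4 ≤ 6 := by linarith
          gcongr
  calc _ ≤ ∑ x ∈ (Finset.Icc 1 b).sigma (fun t =>
        (Finset.univ.powersetCard t : Finset (Finset V)).sigma fun B =>
          (B.sym2 ∩ Ω).powersetCard (2 * t)), graphProb p (cylinder x.2.2 ∅) := by
        refine graphProb_le_sum hp hp1 _ _ _ fun G hG => ?_
        obtain ⟨B, hB, hBb, F, hF1, hF2, hF3⟩ := hG
        refine ⟨⟨B.card, B, F⟩, ?_, ?_⟩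
        · simp only [Finset.mem_sigma, Finset.mem_Icc, Finset.mem_powersetCard]
          refine ⟨⟨hB.card_pos, hBb⟩, ⟨Finset.subset_univ _, trivial⟩, ?_, hF3⟩
          refine Finset.subset_inter hF1 (hF2.trans ?_)
          exact SimpleGraph.edgeFinset_mono le_top
        · exact mem_cylinder.2 ⟨fun e he => SimpleGraph.mem_edgeFinset.1 (hF2 he), by simp⟩
    _ = ∑ t ∈ Finset.Icc 1 b, ∑ B ∈ (Finset.univ.powersetCard t : Finset (Finset V)),
          ∑ F ∈ (B.sym2 ∩ Ω).powersetCard (2 * t), graphProb p (cylinder F ∅) := by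
        rw [Finset.sum_sigma]
        exact Finset.sum_congr rfl fun t _ => by rw [Finset.sum_sigma]
    _ ≤ ∑ t ∈ Finset.Icc 1 b, ∑ _B ∈ (Finset.univ.powersetCard t : Finset (Finset V)),
          ((t ^ 2).choose (2 * t) : ℝ) * p ^ (2 * t) :=
        Finset.sum_le_sum fun t ht => Finset.sum_le_sum fun B hB' => hB t ht B hB'
    _ = ∑ t ∈ Finset.Icc 1 b, (n.choose t : ℝ) * (((t ^ 2).choose (2 * t) : ℝ) * p ^ (2 * t)) := by
        refine Finset.sum_congr rfl fun t _ => ?_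
        rw [Finset.sum_const, Finset.card_powersetCard, nsmul_eq_mul, Finset.card_univ]
    _ ≤ ∑ t ∈ Finset.Icc 1 b, (6 * n * b * p ^ 2) ^ t := Finset.sum_le_sum hterm
    _ ≤ _ := sum_pow_Icc_le (by positivity) hx _ fun t ht => (Finset.mem_Icc.1 ht).1

lemma graphProb_no_edges_between (hp : 0 ≤ p) (hp1 : p ≤ 1) {A C : Finset V}
    (h : Disjoint A C) {N : ℕ} (hN : N ≤ C.card) :
    graphProb p {G : SimpleGraph V | ∀ x ∈ A, ∀ y ∈ C, ¬ G.Adj x y} ≤ (1 - p) ^ (A.card * N) := by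
  have hsub : betweenEdges A C ⊆ (⊤ : SimpleGraph V).edgeFinset := by
    intro e he
    obtain ⟨⟨a, c⟩, hx, rfl⟩ := Finset.mem_image.1 he
    rw [SimpleGraph.mem_edgeFinset, SimpleGraph.mem_edgeSet, SimpleGraph.top_adj]
    have hx := Finset.mem_product.1 hx
    exact fun hac => Finset.disjoint_left.1 h hx.1 (hac ▸ hx.2)
  calc _ ≤ graphProb p (cylinder ∅ (betweenEdges A C)) := by
        refine graphProb_mono hp hp1 fun G hG => mem_cylinder.2 ⟨by simp, fun e he => ?_⟩
        obtain ⟨⟨a, c⟩, hx, rfl⟩ := Finset.mem_image.1 he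
        have hx := Finset.mem_product.1 hx
        exact hG a hx.1 c hx.2
    _ = (1 - p) ^ (A.card * C.card) := by
        rw [graphProb_cylinder (by simp) (by simp) hsub, card_betweenEdges h]
        simp
    _ ≤ _ := pow_le_pow_of_le_one (by linarith) (by linarith) (Nat.mul_le_mul_left _ hN)

/-- Vertex sets of moderate size expand by a factor of more than `K`. -/
lemma graphProb_not_expand_le (hp : 0 ≤ p) (hp1 : p ≤ 1) {K b m N : ℕ} (hK : 1 ≤ K) (hb : 1 ≤ b)
    (hN : N + (K + 1) * m ≤ Fintype.card V)
    (hy : (Real.exp 1 * (K + 1) * Fintype.card V / b) ^ (K + 1) * Real.exp (-(p * N)) ≤ 1 / 2) :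
    graphProb p {G : SimpleGraph V | ∃ A T : Finset V, b < (K + 1) * A.card ∧ A.card ≤ m ∧
        T.card = K * A.card ∧ ∀ x ∈ A, ∀ y, y ∉ A → y ∉ T → ¬ G.Adj x y} ≤
      2 * ((Real.exp 1 * (K + 1) * Fintype.card V / b) ^ (K + 1) * Real.exp (-(p * N))) := by
  set n := Fintype.card V with hn
  set y := (Real.exp 1 * (K + 1) * n / b) ^ (K + 1) * Real.exp (-(p * N)) with hydef
  set s := (Finset.Icc 1 m).filter (fun t => b < (K + 1) * t) with hs
  have hb0 : (0 : ℝ) < b := by exact_mod_cast hb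
  have hK1 : (1 : ℝ) ≤ K := by exact_mod_cast hK
  have hterm : ∀ t ∈ s, (n.choose t : ℝ) * (n.choose (K * t) : ℝ) * (1 - p) ^ (t * N) ≤ y ^ t := by
    intro t ht
    obtain ⟨ht', hbt⟩ := Finset.mem_filter.1 ht
    obtain ⟨ht1, htm⟩ := Finset.mem_Icc.1 ht'
    have ht0 : (0 : ℝ) < t := by exact_mod_cast ht1
    have hbt' : (b : ℝ) ≤ (K + 1) * t := by exact_mod_cast hbt.le
    set z := Real.exp 1 * (K + 1) * n / b with hz
    have hz1 : Real.exp 1 * n / t ≤ z := by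
      rw [hz, div_le_div_iff₀ ht0 hb0]
      have : 0 ≤ Real.exp 1 * n := by positivity
      nlinarith
    have hz2 : Real.exp 1 * n / ((K * t : ℕ) : ℝ) ≤ z := by
      refine le_trans ?_ hz1
      push_cast
      have : (t : ℝ) ≤ K * t := by nlinarith
      gcongr
    have hz0 : 0 ≤ z := by positivity
    have h1 : (n.choose t : ℝ) ≤ z ^ t :=
      (choose_le_exp_mul_div_pow n ht1).trans (by gcongr)
    have h2 : (n.choose (K * t) : ℝ) ≤ z ^ (K * t) :=
      (choose_le_exp_mul_div_pow n (Nat.mul_pos hK ht1)).trans (by gcongr)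
    have h3 : (1 - p) ^ (t * N) ≤ Real.exp (-(p * N)) ^ t := by
      rw [mul_comm t N, pow_mul]
      exact pow_le_pow_left₀ (pow_nonneg (by linarith) _) (one_sub_pow_le_exp hp1 N) t
    have h4 : 0 ≤ (1 - p) ^ (t * N) := pow_nonneg (by linarith) _
    calc _ ≤ z ^ t * z ^ (K * t) * Real.exp (-(p * N)) ^ t := by gcongr
      _ = y ^ t := by
        rw [hydef, mul_pow, ← pow_mul, ← pow_add]
        congr 2
        ring
  calc _ ≤ ∑ x ∈ s.sigma (fun t => (Finset.univ.powersetCard t : Finset (Finset V)) ×ˢ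
          (Finset.univ.powersetCard (K * t) : Finset (Finset V))),
        graphProb p {G : SimpleGraph V | ∀ u ∈ x.2.1, ∀ v ∈ (x.2.1 ∪ x.2.2)ᶜ, ¬ G.Adj u v} := by
        refine graphProb_le_sum hp hp1 _ _ _ fun G hG => ?_
        obtain ⟨A, T, hbA, hAm, hT, hG⟩ := hG
        refine ⟨⟨A.card, A, T⟩, ?_, fun u hu v hv => ?_⟩
        · simp only [hs, Finset.mem_sigma, Finset.mem_filter, Finset.mem_Icc, Finset.mem_product,
            Finset.mem_powersetCard, Finset.subset_univ, true_and, and_true]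
          refine ⟨⟨⟨?_, hAm⟩, hbA⟩, hT⟩
          by_contra h0
          have : A.card = 0 := by omega
          rw [this] at hbA
          omega
        · have hv := Finset.mem_compl.1 hv
          rw [Finset.mem_union, not_or] at hv
          exact hG u hu v hv.1 hv.2
    _ ≤ ∑ x ∈ s.sigma (fun t => (Finset.univ.powersetCard t : Finset (Finset V)) ×ˢ
          (Finset.univ.powersetCard (K * t) : Finset (Finset V))), (1 - p) ^ (x.1 * N) := by
        refine Finset.sum_le_sum fun x hx => ?_
        simp only [hs, Finset.mem_sigma, Finset.mem_filter, Finset.mem_Icc, Finset.mem_product,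
            Finset.mem_powersetCard, Finset.subset_univ, true_and] at hx
        obtain ⟨⟨⟨h1, h2⟩, h3⟩, h4, h5⟩ := hx
        have := graphProb_no_edges_between (p := p) hp hp1 (A := x.2.1) (C := (x.2.1 ∪ x.2.2)ᶜ)
          (N := N) (Finset.disjoint_left.2 fun a ha ha' =>
            Finset.mem_compl.1 ha' (Finset.mem_union_left _ ha)) (by
            rw [Finset.card_compl]
            have h6 := Finset.card_union_le x.2.1 x.2.2
            have h7 : (K + 1) * x.1 ≤ (K + 1) * m := Nat.mul_le_mul_left _ h2
            have h8 : x.2.1.card + x.2.2.card = (K + 1) * x.1 := by rw [h4, h5]; ring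
            omega)
        rwa [h4] at this
    _ = ∑ t ∈ s, (n.choose t : ℝ) * (n.choose (K * t) : ℝ) * (1 - p) ^ (t * N) := by
        rw [Finset.sum_sigma]
        refine Finset.sum_congr rfl fun t _ => ?_
        dsimp only
        rw [Finset.sum_const, Finset.card_product, Finset.card_powersetCard,
          Finset.card_powersetCard, nsmul_eq_mul, Finset.card_univ]
        push_cast
        rfl
    _ ≤ ∑ t ∈ s, y ^ t := Finset.sum_le_sum hterm
    _ ≤ 2 * y := sum_pow_Icc_le (by positivity) hy _
        fun t ht => (Finset.mem_Icc.1 (Finset.mem_filter.1 ht).1).1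

/-- Two disjoint large vertex sets are joined by an edge. -/
lemma graphProb_not_joined_le (hp : 0 ≤ p) (hp1 : p ≤ 1) {m : ℕ} (hm : 1 ≤ m)
    (hz : (Real.exp 1 * Fintype.card V / m) ^ 2 * Real.exp (-(p * m)) ≤ 1) :
    graphProb p {G : SimpleGraph V | ∃ A B : Finset V, A.card = m ∧ B.card = m ∧ Disjoint A B ∧
        ∀ x ∈ A, ∀ y ∈ B, ¬ G.Adj x y} ≤
      (Real.exp 1 * Fintype.card V / m) ^ 2 * Real.exp (-(p * m)) := by
  set n := Fintype.card V with hn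
  have hq : 0 ≤ 1 - p := by linarith
  set P := (Finset.univ.powersetCard m : Finset (Finset V)) with hP
  calc _ ≤ ∑ x ∈ P ×ˢ P, graphProb p
        {G : SimpleGraph V | Disjoint x.1 x.2 ∧ ∀ u ∈ x.1, ∀ v ∈ x.2, ¬ G.Adj u v} := by
        refine graphProb_le_sum hp hp1 _ _ _ fun G hG => ?_
        obtain ⟨A, B, hA, hB, hAB, hG⟩ := hG
        exact ⟨(A, B), by simp [hP, hA, hB], hAB, hG⟩
    _ ≤ ∑ _x ∈ P ×ˢ P, (1 - p) ^ (m * m) := by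
        refine Finset.sum_le_sum fun x hx => ?_
        simp only [hP, Finset.mem_product, Finset.mem_powersetCard, Finset.subset_univ,
          true_and] at hx
        by_cases hd : Disjoint x.1 x.2
        · have := graphProb_no_edges_between (p := p) hp hp1 hd hx.2.ge
          rw [hx.1] at this
          exact (graphProb_mono hp hp1 fun G hG => hG.2).trans this
        · simp only [hd, false_and]
          simp only [graphProb, Set.mem_ofPred_eq, Finset.filter_false, Finset.sum_empty]
          positivity
    _ = (n.choose m : ℝ) ^ 2 * (1 - p) ^ (m * m) := by
        rw [Finset.sum_const, Finset.card_product, hP, Finset.card_powersetCard, nsmul_eq_mul,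
          Finset.card_univ]
        push_cast
        ring
    _ ≤ ((Real.exp 1 * n / m) ^ m) ^ 2 * Real.exp (-(p * m)) ^ m := by
        have h1 := choose_le_exp_mul_div_pow n hm
        have h2 : (1 - p) ^ (m * m) ≤ Real.exp (-(p * m)) ^ m := by
          rw [pow_mul]
          exact pow_le_pow_left₀ (pow_nonneg hq _) (one_sub_pow_le_exp hp1 m) m
        gcongr
    _ = ((Real.exp 1 * n / m) ^ 2 * Real.exp (-(p * m))) ^ m := by
        rw [mul_pow, ← pow_mul, ← pow_mul, mul_comm m 2]
    _ ≤ _ := pow_le_of_le_one (by positivity) hz (by omega)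

end UnionBounds

/-! ### Vertices of small degree exist -/

section SecondMoment

variable {V : Type*} [Fintype V] {p : ℝ}

/-- The neighbourhood of `v` is `S`. -/
noncomputable def exactStar (v : V) (S : Finset V) : Set (SimpleGraph V) :=
  cylinder (starEdges v S) (starEdges v ({v} ∪ S)ᶜ)

lemma neighborFinset_of_mem_exactStar {G : SimpleGraph V} {v : V} {S : Finset V}
    (hG : G ∈ exactStar v S) : G.neighborFinset v = S := by
  obtain ⟨h1, h2⟩ := mem_cylinder.1 hG
  ext x
  rw [SimpleGraph.mem_neighborFinset]
  refine ⟨fun hx => ?_, fun hx => h1 _ (mk_mem_starEdges.2 hx)⟩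
  by_contra hxS
  refine h2 s(v, x) (mk_mem_starEdges.2 ?_) hx
  simp [hxS, hx.ne']

lemma graphProb_exactStar {v : V} {S : Finset V} (hv : v ∉ S) :
    graphProb p (exactStar v S) =
      p ^ S.card * (1 - p) ^ (Fintype.card V - (1 + S.card)) := by
  have h1 : Disjoint S ({v} ∪ S)ᶜ := by
    rw [Finset.disjoint_left]
    intro x hx hx'
    exact Finset.mem_compl.1 hx' (Finset.mem_union_right _ hx)
  have h2 : Disjoint {v} ({v} ∪ S)ᶜ := by simp
  rw [exactStar, graphProb_cylinder (disjoint_starEdges h1)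
    (starEdges_subset_edgeFinset_top (Finset.mem_singleton_self v) (by simpa using hv))
    (starEdges_subset_edgeFinset_top (Finset.mem_singleton_self v) h2),
    card_starEdges, card_starEdges, Finset.card_compl,
    Finset.card_union_of_disjoint (by simpa using hv), Finset.card_singleton]

lemma graphProb_exactStar_inter (hp : 0 ≤ p) (hp1 : p ≤ 1) {u v : V} {S T : Finset V}
    (huv : u ≠ v) (hS : S ⊆ ({u, v} : Finset V)ᶜ) (hT : T ⊆ ({u, v} : Finset V)ᶜ) :
    graphProb p (exactStar u S ∩ exactStar v T) * (1 - p) ≤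
      graphProb p (exactStar u S) * graphProb p (exactStar v T) := by
  have huS : u ∉ S := fun h => by simpa using hS h
  have hvT : v ∉ T := fun h => by simpa using hT h
  have hvS : v ∉ S := fun h => by simpa using hS h
  have huT : u ∉ T := fun h => by simpa using hT h
  have hsub : exactStar u S ∩ exactStar v T ⊆ twoStar {u, v} ∅ {s(u, v)} u v S T := by
    rintro G ⟨h1, h2⟩
    obtain ⟨h1, h1'⟩ := mem_cylinder.1 h1
    obtain ⟨h2, h2'⟩ := mem_cylinder.1 h2
    refine mem_cylinder.2 ⟨fun e he => ?_, fun e he => ?_⟩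
    · rw [Finset.empty_union] at he
      exact (Finset.mem_union.1 he).elim (h1 e) (h2 e)
    · rcases Finset.mem_union.1 he with he | he
      · rw [Finset.mem_singleton.1 he]
        refine h1' _ (mk_mem_starEdges.2 ?_)
        simp [hvS, huv.symm]
      rcases Finset.mem_union.1 he with he | he
      · obtain ⟨x, hx, rfl⟩ := mem_starEdges.1 he
        refine h1' _ (mk_mem_starEdges.2 ?_)
        simp only [Finset.mem_sdiff, Finset.mem_compl, Finset.mem_insert, Finset.mem_singleton,
          not_or] at hx
        simp [hx]
      · obtain ⟨x, hx, rfl⟩ := mem_starEdges.1 he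
        refine h2' _ (mk_mem_starEdges.2 ?_)
        simp only [Finset.mem_sdiff, Finset.mem_compl, Finset.mem_insert, Finset.mem_singleton,
          not_or] at hx
        simp [hx]
  have hc : ({u, v} : Finset V)ᶜ.card = Fintype.card V - 2 := by
    rw [Finset.card_compl, Finset.card_pair huv]
  have hcS := Finset.card_le_card hS
  have hcT := Finset.card_le_card hT
  have hV : 2 ≤ Fintype.card V := (Finset.card_pair huv).symm.le.trans (Finset.card_le_univ _)
  refine (mul_le_mul_of_nonneg_right (graphProb_mono hp hp1 hsub) (by linarith)).trans ?_
  rw [graphProb_twoStar huv (by simp) (by simp) (by simp) (by simp) (by simp)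
    (by simpa using huv) (by simp) hS hT, graphProb_exactStar huS, graphProb_exactStar hvT, hc]
  apply le_of_eq
  rw [hc] at hcS hcT
  rw [Finset.card_empty, zero_add, Finset.card_singleton, mul_mul_mul_comm, ← pow_add, ← pow_add,
    mul_assoc, ← pow_succ]
  congr 2
  omega

/-- The second moment bound for the existence of a vertex of degree `d`. -/
lemma graphProb_lt_minDeg_le (hp : 0 ≤ p) (hp1 : p < 1) (d : ℕ) (U : Finset V)
    {μ : ℝ} (hμ : μ = U.card * (Uᶜ.card.choose d : ℝ) *
      (p ^ d * (1 - p) ^ (Fintype.card V - (1 + d)))) (hμ0 : 0 < μ) :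
    graphProb p {G : SimpleGraph V | d < minDeg G} ≤ 1 / μ + p / (1 - p) := by
  set w := p ^ d * (1 - p) ^ (Fintype.card V - (1 + d)) with hw
  have hq : 0 < 1 - p := by linarith
  set s := U ×ˢ Uᶜ.powersetCard d with hs
  set B : V × Finset V → Set (SimpleGraph V) := fun x => exactStar x.1 x.2 with hB
  have hmem : ∀ x ∈ s, x.1 ∈ U ∧ x.2 ⊆ Uᶜ ∧ x.2.card = d := by
    intro x hx
    obtain ⟨h1, h2⟩ := Finset.mem_product.1 hx
    exact ⟨h1, Finset.mem_powersetCard.1 h2⟩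
  have hnot : ∀ x ∈ s, ∀ y ∈ s, x.1 ∉ y.2 := by
    intro x hx y hy h
    exact Finset.mem_compl.1 ((hmem y hy).2.1 h) (hmem x hx).1
  have hone : ∀ x ∈ s, graphProb p (B x) = w := by
    intro x hx
    rw [hB, graphProb_exactStar (hnot x hx x hx), (hmem x hx).2.2]
  have hscard : (s.card : ℝ) * w = μ := by
    rw [hμ, hs, Finset.card_product, Finset.card_powersetCard]
    push_cast
    ring
  have hsum : ∑ x ∈ s, graphProb p (B x) = μ := by
    rw [Finset.sum_congr rfl hone, Finset.sum_const, nsmul_eq_mul, hscard]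
  have hw0 : 0 ≤ w := by positivity
  have hpair : ∀ x ∈ s, ∀ y ∈ s,
      graphProb p (B x ∩ B y) ≤ (if x = y then w else 0) + w ^ 2 / (1 - p) := by
    intro x hx y hy
    by_cases hxy : x = y
    · subst hxy
      rw [if_pos rfl, Set.inter_self, hone x hx]
      have : 0 ≤ w ^ 2 / (1 - p) := by positivity
      linarith
    rw [if_neg hxy, zero_add]
    by_cases h1 : x.1 = y.1
    · have : B x ∩ B y = ∅ := by
        rw [Set.eq_empty_iff_forall_notMem]
        rintro G ⟨hGx, hGy⟩
        refine hxy (Prod.ext h1 ?_)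
        rw [← neighborFinset_of_mem_exactStar hGx, ← neighborFinset_of_mem_exactStar hGy, h1]
      rw [this]
      simp only [graphProb, Set.mem_empty_iff_false, Finset.filter_false, Finset.sum_empty]
      positivity
    · rw [le_div_iff₀ hq, sq]
      refine (graphProb_exactStar_inter hp hp1.le h1 ?_ ?_).trans_eq ?_
      · intro a ha
        simp only [Finset.mem_compl, Finset.mem_insert, Finset.mem_singleton, not_or]
        exact ⟨fun h => hnot x hx x hx (h ▸ ha), fun h => hnot y hy x hx (h ▸ ha)⟩
      · intro a ha
        simp only [Finset.mem_compl, Finset.mem_insert, Finset.mem_singleton, not_or]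
        exact ⟨fun h => hnot x hx y hy (h ▸ ha), fun h => hnot y hy y hy (h ▸ ha)⟩
      · rw [← hone x hx]
        nth_rewrite 3 [hone x hx]
        rw [← hone y hy]
  have hdouble : ∑ x ∈ s, ∑ y ∈ s, graphProb p (B x ∩ B y) ≤ μ + μ ^ 2 / (1 - p) := by
    calc _ ≤ ∑ x ∈ s, ∑ y ∈ s, ((if x = y then w else 0) + w ^ 2 / (1 - p)) :=
          Finset.sum_le_sum fun x hx => Finset.sum_le_sum fun y hy => hpair x hx y hy
      _ = s.card * w + s.card * (s.card * (w ^ 2 / (1 - p))) := by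
          simp only [Finset.sum_add_distrib, Finset.sum_const, nsmul_eq_mul]
          congr 1
          rw [← nsmul_eq_mul, ← Finset.sum_const]
          exact Finset.sum_congr rfl fun x hx => by rw [Finset.sum_ite_eq, if_pos hx]
      _ = _ := by rw [← hscard]; ring
  have hcheb := graphProb_forall_notMem_mul_sq_le hp hp1.le s B
  rw [hsum] at hcheb
  have hmono : graphProb p {G : SimpleGraph V | d < minDeg G} ≤
      graphProb p {G | ∀ i ∈ s, G ∉ B i} := by
    refine graphProb_mono hp hp1.le fun G hG x hx hGx => ?_
    have h1 := neighborFinset_of_mem_exactStar hGx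
    have h2 : G.degree x.1 = d := by
      rw [← SimpleGraph.card_neighborFinset_eq_degree, h1, (hmem x hx).2.2]
    have h3 : minDeg G ≤ G.degree x.1 := G.minDegree_le_degree x.1
    have h4 : d < minDeg G := hG
    omega
  refine hmono.trans ?_
  have hμ2 : 0 < μ ^ 2 := by positivity
  rw [← mul_le_mul_iff_left₀ hμ2]
  refine hcheb.trans ((sub_le_sub_right hdouble _).trans_eq ?_)
  field_simp
  ring

end SecondMoment

/-! ### Asymptotic estimates -/

section Asymptotics

lemma tendsto_log_natCast : Tendsto (fun n : ℕ => Real.log n) atTop atTop :=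
  Real.tendsto_log_atTop.comp tendsto_natCast_atTop_atTop

lemma tendsto_log_pow_div (j : ℕ) :
    Tendsto (fun n : ℕ => Real.log n ^ j / n) atTop (nhds 0) :=
  (Real.isLittleO_pow_log_id_atTop (n := j)).tendsto_div_nhds_zero.comp
    tendsto_natCast_atTop_atTop

variable {p : ℕ → ℝ}

lemma eventually_edgeProb_nonneg (hlow : ∀ᶠ n : ℕ in atTop, Real.log n ≤ n * p n) :
    ∀ᶠ n in atTop, 0 ≤ p n := by
  filter_upwards [hlow, eventually_ge_atTop 1] with n h1 hn
  have hn0 : (0 : ℝ) < n := by exact_mod_cast hn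
  have : 0 ≤ (n : ℝ) * p n := (Real.log_natCast_nonneg n).trans h1
  exact nonneg_of_mul_nonneg_right this hn0

lemma tendsto_edgeProb (hlow : ∀ᶠ n : ℕ in atTop, Real.log n ≤ n * p n)
    (hup : ∀ᶠ n : ℕ in atTop, n * p n ≤ 2 * Real.log n) : Tendsto p atTop (nhds 0) := by
  have h := (tendsto_log_pow_div 1).const_mul 2
  rw [mul_zero] at h
  refine squeeze_zero' (eventually_edgeProb_nonneg hlow) ?_ h
  filter_upwards [hup, eventually_ge_atTop 1] with n h1 hn
  have hn0 : (0 : ℝ) < n := by exact_mod_cast hn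
  rw [pow_one, ← mul_div_assoc, le_div_iff₀ hn0]
  linarith

lemma eventually_edgeProb_le (hlow : ∀ᶠ n : ℕ in atTop, Real.log n ≤ n * p n)
    (hup : ∀ᶠ n : ℕ in atTop, n * p n ≤ 2 * Real.log n) {ε : ℝ} (hε : 0 < ε) :
    ∀ᶠ n in atTop, p n ≤ ε :=
  ((tendsto_edgeProb hlow hup).eventually (gt_mem_nhds hε)).mono fun _ h => h.le

lemma tendsto_low_degree_bound (L : ℕ) :
    Tendsto (fun n : ℕ => (2 * Real.log n) ^ 2 *
      (L * (2 * Real.log n) ^ L * Real.exp (L + 3)) ^ 2 / n) atTop (nhds 0) := by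
  have h := (tendsto_log_pow_div (2 + L * 2)).const_mul
    (2 ^ 2 * (L * 2 ^ L * Real.exp (L + 3)) ^ 2)
  rw [mul_zero] at h
  refine h.congr fun n => ?_
  rw [pow_add, pow_mul]
  ring

/-- The probability that a fixed vertex has degree below a constant is of order
`(log n) ^ O(1) / n`. -/
lemma low_degree_factor_le {n L : ℕ} {q : ℝ} (hq : 0 ≤ q) (hq1 : q ≤ 1) (hn : L + 3 ≤ n)
    (hn0 : 0 < n) (hlow : Real.log n ≤ n * q) (hup : n * q ≤ 2 * Real.log n) :
    L * (n * q) ^ L * (1 - q) ^ (n - (L + 3)) ≤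
      L * (2 * Real.log n) ^ L * Real.exp (L + 3) / n := by
  have hn1 : (0 : ℝ) < n := by exact_mod_cast hn0
  have h1 : (1 - q) ^ (n - (L + 3)) ≤ Real.exp (L + 3) / n := by
    refine (one_sub_pow_le_exp hq1 _).trans ?_
    have : Real.exp (L + 3) / n = Real.exp (L + 3 - Real.log n) := by
      rw [Real.exp_sub, Real.exp_log hn1]
    rw [this, Real.exp_le_exp, Nat.cast_sub hn]
    push_cast
    have : q * (L + 3) ≤ 1 * (L + 3) := by gcongr
    nlinarith
  rw [mul_div_assoc]
  have : 0 ≤ (1 - q) ^ (n - (L + 3)) := pow_nonneg (by linarith) _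
  gcongr

lemma tendsto_graphProb_adj_low_degree (L : ℕ)
    (hlow : ∀ᶠ n : ℕ in atTop, Real.log n ≤ n * p n)
    (hup : ∀ᶠ n : ℕ in atTop, n * p n ≤ 2 * Real.log n) :
    Tendsto (fun n => graphProb (p n) {G : SimpleGraph (Fin n) |
      ∃ u v, G.degree u < L ∧ G.degree v < L ∧ G.Adj u v}) atTop (nhds 0) := by
  have hp0 := eventually_edgeProb_nonneg hlow
  have hp1 := eventually_edgeProb_le hlow hup one_pos
  refine squeeze_zero' ?_ ?_ (tendsto_low_degree_bound L)
  · filter_upwards [hp0, hp1] with n h0 h1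
    exact graphProb_nonneg h0 h1 _
  · filter_upwards [hlow, hup, hp0, hp1, eventually_ge_atTop (2 * L + 3),
      tendsto_log_natCast.eventually_ge_atTop 1] with n hl hu h0 h1 hn hlog
    have hn0 : 0 < n := by omega
    have hn1 : (0 : ℝ) < n := by exact_mod_cast hn0
    have hb := graphProb_adj_low_degree_le (V := Fin n) (p := p n) (N := n - (L + 3)) (L := L)
      h0 h1 (by rw [Fintype.card_fin]; omega) (by rw [Fintype.card_fin]; linarith)
    rw [Fintype.card_fin] at hb
    refine hb.trans ?_
    have hf := low_degree_factor_le (L := L) h0 h1 (by omega) hn0 hl hu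
    have hq : 0 ≤ 1 - p n := by linarith
    set X := L * (n * p n) ^ L * (1 - p n) ^ (n - (L + 3)) with hX
    set Y := L * (2 * Real.log n) ^ L * Real.exp (L + 3) with hY
    have hX0 : 0 ≤ X := by positivity
    calc (n : ℝ) ^ 2 * (p n * X ^ 2) = n * (n * p n) * X ^ 2 := by ring
      _ ≤ n * (2 * Real.log n) * (Y / n) ^ 2 := by gcongr
      _ = (2 * Real.log n) * Y ^ 2 / n := by field_simp
      _ ≤ (2 * Real.log n) ^ 2 * Y ^ 2 / n := by
        gcongr
        exact le_self_pow₀ (by linarith) (by norm_num)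

lemma tendsto_graphProb_common_neighbor_low_degree (L : ℕ)
    (hlow : ∀ᶠ n : ℕ in atTop, Real.log n ≤ n * p n)
    (hup : ∀ᶠ n : ℕ in atTop, n * p n ≤ 2 * Real.log n) :
    Tendsto (fun n => graphProb (p n) {G : SimpleGraph (Fin n) |
      ∃ u v z, u ≠ v ∧ G.degree u < L ∧ G.degree v < L ∧ G.Adj u z ∧ G.Adj v z})
      atTop (nhds 0) := by
  have hp0 := eventually_edgeProb_nonneg hlow
  have hp1 := eventually_edgeProb_le hlow hup one_pos
  refine squeeze_zero' ?_ ?_ (tendsto_low_degree_bound L)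
  · filter_upwards [hp0, hp1] with n h0 h1
    exact graphProb_nonneg h0 h1 _
  · filter_upwards [hlow, hup, hp0, hp1, eventually_ge_atTop (2 * L + 3),
      tendsto_log_natCast.eventually_ge_atTop 1] with n hl hu h0 h1 hn hlog
    have hn0 : 0 < n := by omega
    have hn1 : (0 : ℝ) < n := by exact_mod_cast hn0
    have hb := graphProb_common_neighbor_low_degree_le (V := Fin n) (p := p n)
      (N := n - (L + 3)) (L := L)
      h0 h1 (by rw [Fintype.card_fin]; omega) (by rw [Fintype.card_fin]; linarith)
    rw [Fintype.card_fin] at hb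
    refine hb.trans ?_
    have hf := low_degree_factor_le (L := L) h0 h1 (by omega) hn0 hl hu
    have hq : 0 ≤ 1 - p n := by linarith
    set X := L * (n * p n) ^ L * (1 - p n) ^ (n - (L + 3)) with hX
    set Y := L * (2 * Real.log n) ^ L * Real.exp (L + 3) with hY
    have hX0 : 0 ≤ X := by positivity
    calc (n : ℝ) ^ 3 * (p n ^ 2 * X ^ 2) = n * (n * p n) ^ 2 * X ^ 2 := by ring
      _ ≤ n * (2 * Real.log n) ^ 2 * (Y / n) ^ 2 := by gcongr
      _ = (2 * Real.log n) ^ 2 * Y ^ 2 / n := by field_simp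

/-- The size up to which vertex sets are sparse. -/
noncomputable def sparseSize (n : ℕ) : ℕ := ⌊(n : ℝ) / Real.log n ^ 3⌋₊

/-- The size from which disjoint vertex sets are joined by an edge. -/
noncomputable def joinedSize (n : ℕ) : ℕ := ⌈(n : ℝ) / √(Real.log n)⌉₊

lemma sparseSize_le (n : ℕ) : (sparseSize n : ℝ) ≤ n / Real.log n ^ 3 := by
  have := Real.log_natCast_nonneg n
  exact Nat.floor_le (by positivity)

lemma eventually_le_sparseSize :
    ∀ᶠ n : ℕ in atTop, 1 ≤ sparseSize n ∧ (n : ℝ) ≤ 2 * Real.log n ^ 3 * sparseSize n := by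
  filter_upwards [(tendsto_log_pow_div 3).eventually (gt_mem_nhds one_pos),
    tendsto_log_natCast.eventually_ge_atTop 1, eventually_ge_atTop 1] with n h hlog hn
  have hn0 : (0 : ℝ) < n := by exact_mod_cast hn
  have hl : 0 < Real.log n ^ 3 := by positivity
  rw [div_lt_one hn0] at h
  have h1 : 1 ≤ (n : ℝ) / Real.log n ^ 3 := by rw [le_div_iff₀ hl]; linarith
  have h2 : 1 ≤ sparseSize n := Nat.one_le_floor_iff _ |>.2 h1
  refine ⟨h2, ?_⟩
  have h3 : (n : ℝ) / Real.log n ^ 3 < sparseSize n + 1 := Nat.lt_floor_add_one _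
  have h4 : (1 : ℝ) ≤ sparseSize n := by exact_mod_cast h2
  rw [div_lt_iff₀ hl] at h3
  nlinarith

lemma tendsto_sqrt_log : Tendsto (fun n : ℕ => √(Real.log n)) atTop atTop :=
  Real.tendsto_sqrt_atTop.comp tendsto_log_natCast

lemma le_joinedSize (n : ℕ) : (n : ℝ) / √(Real.log n) ≤ joinedSize n := Nat.le_ceil _

lemma eventually_joinedSize_le (K : ℕ) :
    ∀ᶠ n : ℕ in atTop, 1 ≤ joinedSize n ∧ 2 * ((K + 1) * joinedSize n) ≤ n := by
  filter_upwards [tendsto_sqrt_log.eventually_ge_atTop (4 * (K + 1) : ℝ),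
    eventually_ge_atTop (4 * (K + 1))] with n h hn
  have hs0 : 0 < √(Real.log n) := lt_of_lt_of_le (by positivity) h
  have hn' : (4 * (K + 1) : ℝ) ≤ n := by exact_mod_cast hn
  have hn0 : (0 : ℝ) < n := lt_of_lt_of_le (by positivity) hn'
  refine ⟨Nat.one_le_ceil_iff.2 (by positivity), ?_⟩
  have h1 : (joinedSize n : ℝ) < n / √(Real.log n) + 1 := Nat.ceil_lt_add_one (by positivity)
  have h2 : (n : ℝ) / √(Real.log n) ≤ n / (4 * (K + 1)) := by gcongr
  have h3 : (n : ℝ) / (4 * (K + 1)) * (4 * (K + 1)) = n := by field_simp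
  have h4 : (2 * ((K + 1) * joinedSize n) : ℝ) ≤ n := by
    have hK : (0 : ℝ) < K + 1 := by positivity
    nlinarith
  exact_mod_cast h4

lemma tendsto_graphProb_dense
    (hlow : ∀ᶠ n : ℕ in atTop, Real.log n ≤ n * p n)
    (hup : ∀ᶠ n : ℕ in atTop, n * p n ≤ 2 * Real.log n) :
    Tendsto (fun n => graphProb (p n) {G : SimpleGraph (Fin n) |
      ∃ B : Finset (Fin n), B.Nonempty ∧ B.card ≤ sparseSize n ∧
        ∃ F : Finset (Sym2 (Fin n)), F ⊆ B.sym2 ∧ F ⊆ G.edgeFinset ∧ F.card = 2 * B.card})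
      atTop (nhds 0) := by
  have hp0 := eventually_edgeProb_nonneg hlow
  have hp1 := eventually_edgeProb_le hlow hup one_pos
  have hlim : Tendsto (fun n : ℕ => 48 * (Real.log n)⁻¹) atTop (nhds 0) := by
    simpa using (tendsto_inv_atTop_zero.comp tendsto_log_natCast).const_mul 48
  refine squeeze_zero' ?_ ?_ hlim
  · filter_upwards [hp0, hp1] with n h0 h1
    exact graphProb_nonneg h0 h1 _
  · filter_upwards [hlow, hup, hp0, hp1, eventually_ge_atTop 1,
      tendsto_log_natCast.eventually_ge_atTop 48] with n hl hu h0 h1 hn hlog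
    have hl0 : 0 < Real.log n := by linarith
    have hx : 6 * (n : ℝ) * sparseSize n * p n ^ 2 ≤ 24 * (Real.log n)⁻¹ := by
      calc 6 * (n : ℝ) * sparseSize n * p n ^ 2
          ≤ 6 * (n : ℝ) * (n / Real.log n ^ 3) * p n ^ 2 := by
            gcongr
            exact sparseSize_le n
        _ = 6 * (n * p n) ^ 2 / Real.log n ^ 3 := by ring
        _ ≤ 6 * (2 * Real.log n) ^ 2 / Real.log n ^ 3 := by gcongr
        _ = 24 * (Real.log n)⁻¹ := by field_simp; ring
    have hinv : (Real.log n)⁻¹ ≤ 48⁻¹ := inv_anti₀ (by norm_num) hlog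
    have := graphProb_dense_le (V := Fin n) (p := p n) (b := sparseSize n) h0 h1
      (by rw [Fintype.card_fin]; linarith)
    rw [Fintype.card_fin] at this
    linarith

lemma tendsto_pow_mul_exp_neg_half_log (C : ℝ) (j : ℕ) :
    Tendsto (fun n : ℕ => C * Real.log n ^ j * Real.exp (-(Real.log n / 2))) atTop (nhds 0) := by
  have h := ((tendsto_rpow_mul_exp_neg_mul_atTop_nhds_zero j (1 / 2) (by norm_num)).comp
    tendsto_log_natCast).const_mul C
  rw [mul_zero] at h
  refine h.congr fun n => ?_
  simp only [Function.comp_apply, Real.rpow_natCast]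
  rw [mul_assoc]
  congr 3
  ring

lemma tendsto_graphProb_not_expand {K : ℕ} (hK : 1 ≤ K)
    (hlow : ∀ᶠ n : ℕ in atTop, Real.log n ≤ n * p n)
    (hup : ∀ᶠ n : ℕ in atTop, n * p n ≤ 2 * Real.log n) :
    Tendsto (fun n => graphProb (p n) {G : SimpleGraph (Fin n) |
      ∃ A T : Finset (Fin n), sparseSize n < (K + 1) * A.card ∧ A.card ≤ joinedSize n ∧
        T.card = K * A.card ∧ ∀ x ∈ A, ∀ y, y ∉ A → y ∉ T → ¬ G.Adj x y})
      atTop (nhds 0) := by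
  have hp0 := eventually_edgeProb_nonneg hlow
  have hp1 := eventually_edgeProb_le hlow hup one_pos
  set C : ℝ := (2 * Real.exp 1 * (K + 1)) ^ (K + 1) with hC
  have hlim := tendsto_pow_mul_exp_neg_half_log C (3 * (K + 1))
  have hlim2 := hlim.const_mul 2
  rw [mul_zero] at hlim2
  refine squeeze_zero' ?_ ?_ hlim2
  · filter_upwards [hp0, hp1] with n h0 h1
    exact graphProb_nonneg h0 h1 _
  · filter_upwards [hlow, hup, hp0, hp1, eventually_ge_atTop 1,
      tendsto_log_natCast.eventually_ge_atTop 1, eventually_le_sparseSize,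
      eventually_joinedSize_le K, hlim.eventually (gt_mem_nhds (by norm_num : (0 : ℝ) < 1 / 2))]
      with n hl hu h0 h1 hn hlog hb hm hsmall
    obtain ⟨hb1, hb2⟩ := hb
    have hb0 : (0 : ℝ) < sparseSize n := by exact_mod_cast hb1
    have hz : Real.exp 1 * (K + 1) * n / sparseSize n ≤
        2 * Real.exp 1 * (K + 1) * Real.log n ^ 3 := by
      rw [div_le_iff₀ hb0]
      have : 0 ≤ Real.exp 1 * (K + 1) := by positivity
      nlinarith
    have hN : Real.log n / 2 ≤ p n * ((n - (K + 1) * joinedSize n : ℕ) : ℝ) := by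
      have : (n : ℝ) / 2 ≤ ((n - (K + 1) * joinedSize n : ℕ) : ℝ) := by
        rw [Nat.cast_sub (by omega)]
        have : ((2 * ((K + 1) * joinedSize n) : ℕ) : ℝ) ≤ n := by exact_mod_cast hm.2
        push_cast at this ⊢
        linarith
      nlinarith
    have hy : (Real.exp 1 * (K + 1) * n / sparseSize n) ^ (K + 1) *
        Real.exp (-(p n * ((n - (K + 1) * joinedSize n : ℕ) : ℝ))) ≤
        C * Real.log n ^ (3 * (K + 1)) * Real.exp (-(Real.log n / 2)) := by
      calc _ ≤ (2 * Real.exp 1 * (K + 1) * Real.log n ^ 3) ^ (K + 1) *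
            Real.exp (-(Real.log n / 2)) := by gcongr
        _ = _ := by rw [hC, mul_pow _ (Real.log n ^ 3), ← pow_mul]
    have := graphProb_not_expand_le (V := Fin n) (p := p n) (K := K) (b := sparseSize n)
      (m := joinedSize n) (N := n - (K + 1) * joinedSize n) h0 h1 hK hb1
      (by rw [Fintype.card_fin]; omega) (by rw [Fintype.card_fin]; linarith)
    rw [Fintype.card_fin] at this
    linarith

lemma tendsto_graphProb_not_joined
    (hlow : ∀ᶠ n : ℕ in atTop, Real.log n ≤ n * p n)
    (hup : ∀ᶠ n : ℕ in atTop, n * p n ≤ 2 * Real.log n) :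
    Tendsto (fun n => graphProb (p n) {G : SimpleGraph (Fin n) |
      ∃ A B : Finset (Fin n), A.card = joinedSize n ∧ B.card = joinedSize n ∧ Disjoint A B ∧
        ∀ x ∈ A, ∀ y ∈ B, ¬ G.Adj x y})
      atTop (nhds 0) := by
  have hp0 := eventually_edgeProb_nonneg hlow
  have hp1 := eventually_edgeProb_le hlow hup one_pos
  have hlim : Tendsto (fun n : ℕ => Real.exp 1 ^ 2 *
      (√(Real.log n) ^ 2 * Real.exp (-√(Real.log n)))) atTop (nhds 0) := by
    have h := ((Real.tendsto_pow_mul_exp_neg_atTop_nhds_zero 2).comp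
      tendsto_sqrt_log).const_mul (Real.exp 1 ^ 2)
    rwa [mul_zero] at h
  refine squeeze_zero' ?_ ?_ hlim
  · filter_upwards [hp0, hp1] with n h0 h1
    exact graphProb_nonneg h0 h1 _
  · filter_upwards [hlow, hup, hp0, hp1, eventually_ge_atTop 1,
      tendsto_log_natCast.eventually_ge_atTop 1,
      eventually_joinedSize_le 0, hlim.eventually (gt_mem_nhds one_pos)]
      with n hl hu h0 h1 hn hlog hm hsmall
    have hs0 : 0 < √(Real.log n) := Real.sqrt_pos.2 (by linarith)
    have hm0 : (0 : ℝ) < joinedSize n := by exact_mod_cast hm.1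
    have hjs := le_joinedSize n
    have hz : Real.exp 1 * n / joinedSize n ≤ Real.exp 1 * √(Real.log n) := by
      rw [div_le_iff₀ hm0, mul_assoc]
      rw [div_le_iff₀ hs0] at hjs
      gcongr
      linarith
    have he : √(Real.log n) ≤ p n * joinedSize n := by
      calc √(Real.log n) = Real.log n / √(Real.log n) := by rw [Real.div_sqrt]
        _ ≤ n * p n / √(Real.log n) := by gcongr
        _ = p n * (n / √(Real.log n)) := by ring
        _ ≤ _ := by gcongr
    have hy : (Real.exp 1 * n / joinedSize n) ^ 2 * Real.exp (-(p n * joinedSize n)) ≤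
        Real.exp 1 ^ 2 * (√(Real.log n) ^ 2 * Real.exp (-√(Real.log n))) := by
      calc _ ≤ (Real.exp 1 * √(Real.log n)) ^ 2 * Real.exp (-√(Real.log n)) := by gcongr
        _ = _ := by ring
    have := graphProb_not_joined_le (V := Fin n) (p := p n) (m := joinedSize n) h0 h1 hm.1
      (by rw [Fintype.card_fin]; linarith)
    rw [Fintype.card_fin] at this
    linarith

end Asymptotics

/-! ### The minimum degree, and conclusion -/

section Conclusion

variable {p : ℕ → ℝ}

lemma exp_neg_le_one_sub_pow {q : ℝ} (hq1 : q ≤ 1 / 2) (n : ℕ) :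
    Real.exp (-(n * q + 2 * (n * q ^ 2))) ≤ (1 - q) ^ n := by
  have h0 : 0 < 1 - q := by linarith
  have h1 : -(q + 2 * q ^ 2) ≤ Real.log (1 - q) := by
    refine le_trans ?_ (Real.one_sub_inv_le_log_of_pos h0)
    have : (1 - q)⁻¹ ≤ 1 + q + 2 * q ^ 2 := by
      rw [inv_le_iff_one_le_mul₀ h0]
      nlinarith [mul_nonneg (sq_nonneg q) (by linarith : 0 ≤ 1 - 2 * q)]
    linarith
  calc _ ≤ Real.exp (n * Real.log (1 - q)) := by
        rw [Real.exp_le_exp]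
        have := mul_le_mul_of_nonneg_left h1 (Nat.cast_nonneg (α := ℝ) n)
        linarith
    _ = _ := by rw [Real.exp_nat_mul, Real.exp_log h0]

lemma tendsto_graphProb_lt_minDeg (k : ℕ)
    (hlow : ∀ᶠ n : ℕ in atTop, Real.log n ≤ n * p n)
    (hup : ∀ᶠ n : ℕ in atTop, n * p n ≤ 2 * Real.log n)
    (hup' : ∀ᶠ n : ℕ in atTop, n * p n ≤ Real.log n + (k + 1) * Real.log (Real.log n)) :
    Tendsto (fun n => graphProb (p n) {G : SimpleGraph (Fin n) | k + 2 < minDeg G})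
      atTop (nhds 0) := by
  have hp0 := eventually_edgeProb_nonneg hlow
  have hp1 := eventually_edgeProb_le hlow hup (by norm_num : (0 : ℝ) < 1 / 2)
  set d := k + 2 with hd
  set c : ℝ := (4 * 4 ^ d * d.factorial * Real.exp 1)⁻¹ with hc
  have hc0 : 0 < c := by positivity
  have hlim : Tendsto (fun n : ℕ => c⁻¹ * (Real.log n)⁻¹ + 2 * p n) atTop (nhds 0) := by
    simpa using ((tendsto_inv_atTop_zero.comp tendsto_log_natCast).const_mul c⁻¹).add
      ((tendsto_edgeProb hlow hup).const_mul 2)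
  refine squeeze_zero' ?_ ?_ hlim
  · filter_upwards [hp0, hp1] with n h0 h1
    exact graphProb_nonneg h0 (by linarith) _
  · filter_upwards [hlow, hup, hup', hp0, hp1, eventually_ge_atTop (4 * d + 4),
      tendsto_log_natCast.eventually_ge_atTop 1,
      (tendsto_log_pow_div 2).eventually (gt_mem_nhds (by norm_num : (0 : ℝ) < 1 / 8))]
      with n hl hu hu' h0 h1 hn hlog hsq
    have hn0 : (0 : ℝ) < n := by exact_mod_cast (by omega : 0 < n)
    have hl0 : 0 < Real.log n := by linarith
    have hq0 : 0 < 1 - p n := by linarith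
    obtain ⟨U, -, hU⟩ := Finset.exists_subset_card_eq
      (s := (Finset.univ : Finset (Fin n))) (n := n / 2)
      (by rw [Finset.card_univ, Fintype.card_fin]; omega)
    have hUc : Uᶜ.card = n - n / 2 := by rw [Finset.card_compl, hU, Fintype.card_fin]
    have hUn : (n : ℝ) / 4 ≤ U.card := by
      rw [hU, div_le_iff₀ (by norm_num)]
      exact_mod_cast (by omega : n ≤ n / 2 * 4)
    have hch : (n / 4 : ℝ) ^ d / d.factorial ≤ (Uᶜ.card.choose d : ℝ) := by
      have h2 : ((Uᶜ.card + 1 - d : ℕ) : ℝ) ^ d / d.factorial ≤ (Uᶜ.card.choose d : ℝ) :=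
        Nat.pow_le_choose d Uᶜ.card
      refine le_trans ?_ h2
      have : (n / 4 : ℝ) ≤ ((Uᶜ.card + 1 - d : ℕ) : ℝ) := by
        rw [hUc, div_le_iff₀ (by norm_num)]
        exact_mod_cast (by omega : n ≤ (n - n / 2 + 1 - d) * 4)
      gcongr
    have hexp : Real.exp (-1) * ((n : ℝ)⁻¹ * (Real.log n ^ (k + 1))⁻¹) ≤
        (1 - p n) ^ (n - (1 + d)) := by
      have hsq' : 2 * (n * p n ^ 2) ≤ 1 := by
        have : 2 * (n * p n ^ 2) = 2 * (n * p n) ^ 2 / n := by field_simp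
        rw [this]
        calc 2 * (n * p n) ^ 2 / n ≤ 2 * (2 * Real.log n) ^ 2 / n := by gcongr
          _ = 8 * (Real.log n ^ 2 / n) := by ring
          _ ≤ 1 := by linarith
      calc _ = Real.exp (-(1 + (Real.log n + (k + 1) * Real.log (Real.log n)))) := by
            have e1 : (n : ℝ)⁻¹ = Real.exp (-Real.log n) := by
              rw [Real.exp_neg, Real.exp_log hn0]
            have e2 : (Real.log n ^ (k + 1))⁻¹ = Real.exp (-((k + 1) * Real.log (Real.log n))) := by
              rw [Real.exp_neg, ← Nat.cast_add_one, Real.exp_nat_mul, Real.exp_log hl0]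
            rw [e1, e2, ← Real.exp_add, ← Real.exp_add]
            congr 1
            ring
        _ ≤ Real.exp (-(n * p n + 2 * (n * p n ^ 2))) := by
            rw [Real.exp_le_exp]
            linarith
        _ ≤ (1 - p n) ^ n := exp_neg_le_one_sub_pow h1 n
        _ ≤ _ := pow_le_pow_of_le_one hq0.le (by linarith) (Nat.sub_le _ _)
    set μ := U.card * (Uᶜ.card.choose d : ℝ) *
      (p n ^ d * (1 - p n) ^ (n - (1 + d))) with hμ
    have hμc : c * Real.log n ≤ μ := by
      calc c * Real.log n = (n / 4) * ((n / 4) ^ d / d.factorial) *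
            ((Real.log n / n) ^ d *
              (Real.exp (-1) * ((n : ℝ)⁻¹ * (Real.log n ^ (k + 1))⁻¹))) := by
            rw [hc, Real.exp_neg, div_pow, div_pow,
              show Real.log n ^ d = Real.log n ^ (k + 1) * Real.log n from pow_succ _ _]
            field_simp
        _ ≤ μ := by
            have : Real.log n / n ≤ p n := by
              rw [div_le_iff₀ hn0]; linarith
            rw [hμ]
            gcongr
    have hμ0 : 0 < μ := lt_of_lt_of_le (by positivity) hμc
    have := graphProb_lt_minDeg_le (V := Fin n) (p := p n) h0 (by linarith) d U
      (μ := μ) (by rw [Fintype.card_fin]; convert hμ) hμ0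
    refine this.trans (add_le_add ?_ ?_)
    · rw [← mul_inv, ← one_div]
      exact one_div_le_one_div_of_le (by positivity) hμc
    · rw [div_le_iff₀ hq0]
      nlinarith

lemma graphProb_union_le {V : Type*} [Fintype V] {q : ℝ} (hq : 0 ≤ q) (hq1 : q ≤ 1)
    (A B : Set (SimpleGraph V)) : graphProb q (A ∪ B) ≤ graphProb q A + graphProb q B := by
  have := graphProb_le_sum hq hq1 (Finset.univ : Finset Bool) (A ∪ B)
    (fun i => if i then A else B) (fun G hG => by
      rcases hG with h | h
      · exact ⟨true, by simp, by simpa using h⟩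
      · exact ⟨false, by simp, by simpa using h⟩)
  simpa using this

/-- A property that follows from expansion and a bound on the minimum degree holds almost
surely. -/
lemma tendsto_graphProb_of_isExpanding (k : ℕ) {K L : ℕ} (hK : 1 ≤ K)
    (hlow : ∀ᶠ n : ℕ in atTop, Real.log n ≤ n * p n)
    (hup : ∀ᶠ n : ℕ in atTop, n * p n ≤ 2 * Real.log n)
    (hup' : ∀ᶠ n : ℕ in atTop, n * p n ≤ Real.log n + (k + 1) * Real.log (Real.log n))
    {A : (n : ℕ) → Set (SimpleGraph (Fin n))}
    (hA : ∀ᶠ n in atTop, ∀ G : SimpleGraph (Fin n),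
      IsExpanding G L K (sparseSize n) (joinedSize n) → minDeg G ≤ k + 2 → G ∈ A n) :
    Tendsto (fun n => graphProb (p n) (A n)) atTop (nhds 1) := by
  have hp0 := eventually_edgeProb_nonneg hlow
  have hp1 := eventually_edgeProb_le hlow hup one_pos
  have hlim := (((((tendsto_graphProb_adj_low_degree L hlow hup).add
    (tendsto_graphProb_common_neighbor_low_degree L hlow hup)).add
    (tendsto_graphProb_dense hlow hup)).add
    (tendsto_graphProb_not_expand hK hlow hup)).add
    (tendsto_graphProb_not_joined hlow hup)).add
    (tendsto_graphProb_lt_minDeg k hlow hup hup')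
  simp only [add_zero] at hlim
  have hcompl : Tendsto (fun n => graphProb (p n) (A n)ᶜ) atTop (nhds 0) := by
    refine squeeze_zero' ?_ ?_ hlim
    · filter_upwards [hp0, hp1] with n h0 h1
      exact graphProb_nonneg h0 h1 _
    · filter_upwards [hp0, hp1, hA] with n h0 h1 hAn
      refine le_trans ?_ ((graphProb_union_le h0 h1 _ _).trans (add_le_add_left
        ((graphProb_union_le h0 h1 _ _).trans (add_le_add_left
        ((graphProb_union_le h0 h1 _ _).trans (add_le_add_left
        ((graphProb_union_le h0 h1 _ _).trans (add_le_add_left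
        (graphProb_union_le h0 h1 _ _) _)) _)) _)) _))
      refine graphProb_mono h0 h1 fun G hG => ?_
      by_contra hbad
      simp only [Set.mem_union, not_or] at hbad
      obtain ⟨⟨⟨⟨⟨b1, b2⟩, b3⟩, b4⟩, b5⟩, b6⟩ := hbad
      refine hG (hAn G ⟨?_, ?_, ?_, ?_, ?_⟩ (not_lt.1 b6))
      · exact fun u v hu hv huv => b1 ⟨u, v, hu, hv, huv⟩
      · exact fun u v z huv hu hv huz hvz => b2 ⟨u, v, z, huv, hu, hv, huz, hvz⟩
      · exact fun B hB hBb F hF hFG hFc => b3 ⟨B, hB, hBb, F, hF, hFG, hFc⟩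
      · intro S T hS hSm hT
        by_contra hno
        push Not at hno
        exact b4 ⟨S, T, hS, hSm, hT, hno⟩
      · intro S T hS hT hd
        by_contra hno
        push Not at hno
        exact b5 ⟨S, T, hS, hT, hd, hno⟩
  have h := hcompl.const_sub 1
  rw [sub_zero] at h
  refine h.congr fun n => ?_
  rw [graphProb_compl, sub_sub_cancel]

/-- The bounds on the expected average degree at the threshold considered. -/
lemma eventually_threshold_bounds (k : ℕ) :
    ∀ᶠ n : ℕ in atTop, Real.log n ≤ n * ((Real.log n + ((k : ℝ) + 1) * Real.log (Real.log n) -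
          Real.log (Real.log (Real.log n))) / n) ∧
      n * ((Real.log n + ((k : ℝ) + 1) * Real.log (Real.log n) -
          Real.log (Real.log (Real.log n))) / n) ≤ 2 * Real.log n ∧
      n * ((Real.log n + ((k : ℝ) + 1) * Real.log (Real.log n) -
          Real.log (Real.log (Real.log n))) / n) ≤
        Real.log n + (k + 1) * Real.log (Real.log n) := by
  have hll : Tendsto (fun n : ℕ => Real.log (Real.log n)) atTop atTop :=
    Real.tendsto_log_atTop.comp tendsto_log_natCast
  have hsmall : Tendsto (fun n : ℕ => Real.log (Real.log n) / Real.log n) atTop (nhds 0) :=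
    Real.isLittleO_log_id_atTop.tendsto_div_nhds_zero.comp tendsto_log_natCast
  filter_upwards [eventually_ge_atTop 1, tendsto_log_natCast.eventually_ge_atTop 1,
    hll.eventually_ge_atTop 1,
    hsmall.eventually (gt_mem_nhds (by positivity : (0 : ℝ) < 1 / (k + 1)))] with n hn h1 h2 h3
  have hn0 : (n : ℝ) ≠ 0 := by exact_mod_cast (by omega : n ≠ 0)
  rw [mul_div_cancel₀ _ hn0]
  have h4 : 0 ≤ Real.log (Real.log (Real.log n)) := Real.log_nonneg h2
  have h5 : Real.log (Real.log (Real.log n)) ≤ Real.log (Real.log n) :=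
    Real.log_le_self (by linarith)
  have h6 : (k + 1) * Real.log (Real.log n) ≤ Real.log n := by
    rw [div_lt_div_iff₀ (by linarith) (by positivity)] at h3
    linarith
  have h7 : 0 ≤ (k : ℝ) * Real.log (Real.log n) := by positivity
  refine ⟨by linarith, by linarith, by linarith⟩

end Conclusion

/-- Almost surely
`δ(G(n,p)) − 1 = λ(G(n,p)) − 1 = κ(G(n,p)) − 1 ≤ κ₃(G(n,p)) ≤ λ₃(G(n,p)) ≤ κ(G(n,p)) = λ(G(n,p)) = δ(G(n,p))`
for `p(n) = (log n + (k+1) log log n − log log log n)/n`. -/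
theorem sandwich_as (k : ℕ) (hk : 1 ≤ k) :
    Tendsto (fun n : ℕ =>
      gnpProb n ((Real.log n + ((k : ℝ) + 1) * Real.log (Real.log n) -
          Real.log (Real.log (Real.log n))) / n)
        {G : SimpleGraph (Fin n) |
          minDeg G - 1 = edgeConnectivity G - 1 ∧
          edgeConnectivity G - 1 = vertexConnectivity G - 1 ∧
          vertexConnectivity G - 1 ≤ genKappa 3 G ∧
          genKappa 3 G ≤ genLambda 3 G ∧
          genLambda 3 G ≤ vertexConnectivity G ∧
          vertexConnectivity G = edgeConnectivity G ∧
          edgeConnectivity G = minDeg G})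
      atTop (nhds 1) := by
  have h := eventually_threshold_bounds k
  simp only [gnpProb_eq_graphProb]
  refine tendsto_graphProb_of_isExpanding k (K := 6 * (k + 2) + 3)
    (L := 8 * (6 * (k + 2) + 3 + 1)) (by omega) (h.mono fun n hn => hn.1)
    (h.mono fun n hn => hn.2.1) (h.mono fun n hn => hn.2.2) ?_
  filter_upwards [eventually_joinedSize_le (6 * (k + 2) + 3)] with n hm G hG hdeg
  exact hG.sandwich le_rfl (by rw [Fintype.card_fin]; omega) hm.1 (by omega)
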